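/- arXiv:1811.06703 — 7 statements merged into one kernel-verified Lean document; each statement's English description precedes it below -/
import Mathlib

section
/- Let X_{n,1},…,X_{n,λ} be i.i.d. random elements of X with law P_{θ_n} given θ_n, and let W be the rank-based weight function defined from nonincreasing constants w_1 ≥ … ≥ w_λ by W(i; x_1,…,x_λ) = Σ_{j=k}^{k+l} w_{j+1}/(l+1) with k = #{j ≠ i : f(x_j) < f(x_i)} and l = #{j ≠ i : f(x_j) = f(x_i)}. Then for any P_{θ_n}-integrable g: X × Θ → R^D, the random vector Y_n = Σ_{i=1}^{λ} W(i; X_{n,1},…,X_{n,λ}) g(X_{n,i}; θ_n) is integrable and its conditional expectation given θ_n equals ∫_X u(q^<_{θ_n}(f(x)), q^=_{θ_n}(f(x))) g(x; θ_n) P_{θ_n}(dx), where q^<_{θ_n}(s) = P_{θ_n}[f(x) < s], q^=_{θ_n}(s) = P_{θ_n}[f(x) = s], and u(p,q) = Σ_{k=0}^{λ−1} Σ_{l=0}^{λ−k−1} ( Σ_{j=k}^{k+l} w_{j+1}/(l+1) ) · λ · P_T(λ−1, k, l, p, q) with P_T(n,k,l,p,q) = n!/(k! l! (n−k−l)!)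 · p^k q^l (1−p−q)^{n−k−l} the trinomial probability mass function. -/
open MeasureTheory Finset

/-- The rank-based weight `W(i; x₁,…,x_λ) = (Σ_{j=k}^{k+l} w_{j+1})/(l+1)` where
`k = #{j ≠ i : f(x_j) < f(x_i)}` and `l = #{j ≠ i : f(x_j) = f(x_i)}`.
Here `w : ℕ → ℝ` is `0`-based, i.e. `w 0` plays the role of `w₁`. -/
noncomputable def rankWeight {X : Type} (f : X → ℝ) (lam : ℕ) (w : ℕ → ℝ)
    (i : Fin lam) (x : Fin lam → X) : ℝ :=
  (∑ j ∈ Finset.Icc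
      ((Finset.univ.filter fun j' : Fin lam => j' ≠ i ∧ f (x j') < f (x i)).card)
      (((Finset.univ.filter fun j' : Fin lam => j' ≠ i ∧ f (x j') < f (x i)).card)
        + ((Finset.univ.filter fun j' : Fin lam => j' ≠ i ∧ f (x j') = f (x i)).card)),
    w j)
  / (((Finset.univ.filter fun j' : Fin lam => j' ≠ i ∧ f (x j') = f (x i)).card : ℝ) + 1)

/-- The trinomial probability mass function
`P_T(n,k,l,p,q) = n!/(k! l! (n−k−l)!) pᵏ qˡ (1−p−q)^{n−k−l}`. -/
noncomputable def trinomialPMF (n k l : ℕ) (p q : ℝ) : ℝ :=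
  ((n.factorial : ℝ) / ((k.factorial : ℝ) * (l.factorial : ℝ) * ((n - k - l).factorial : ℝ)))
    * p ^ k * q ^ l * (1 - p - q) ^ (n - k - l)

/-- `u(p,q) = Σ_{k=0}^{λ−1} Σ_{l=0}^{λ−k−1} (Σ_{j=k}^{k+l} w_{j+1}/(l+1)) λ P_T(λ−1,k,l,p,q)`
(with `0`-based weights `w`). -/
noncomputable def uWeight (lam : ℕ) (w : ℕ → ℝ) (p q : ℝ) : ℝ :=
  ∑ k ∈ Finset.range lam, ∑ l ∈ Finset.range (lam - k),
    (∑ j ∈ Finset.Icc k (k + l), w j / ((l : ℝ) + 1)) * (lam : ℝ) * trinomialPMF (lam - 1) k l p q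

/-- number of coordinates below `s` -/
noncomputable def cntLt {X : Type} (f : X → ℝ) (n : ℕ) (s : ℝ) (y : Fin n → X) : ℕ :=
  ∑ j : Fin n, if f (y j) < s then 1 else 0

/-- number of coordinates equal to `s` -/
noncomputable def cntEq {X : Type} (f : X → ℝ) (n : ℕ) (s : ℝ) (y : Fin n → X) : ℕ :=
  ∑ j : Fin n, if f (y j) = s then 1 else 0

/-- shift in the first variable -/
def shA : Module.End ℝ (ℕ → ℕ → ℝ) where
  toFun c := fun k l => c (k + 1) l
  map_add' _ _ := rfl
  map_smul' _ _ := rfl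

/-- shift in the second variable -/
def shB : Module.End ℝ (ℕ → ℕ → ℝ) where
  toFun c := fun k l => c k (l + 1)
  map_add' _ _ := rfl
  map_smul' _ _ := rfl

lemma shA_pow (m : ℕ) (c : ℕ → ℕ → ℝ) (k l : ℕ) : (shA ^ m) c k l = c (k + m) l := by
  induction m generalizing k with
  | zero => simp
  | succ m ih =>
    rw [pow_succ', Module.End.mul_apply]
    change (shA ^ m) c (k + 1) l = _
    rw [ih]; congr 1; omega

lemma shB_pow (m : ℕ) (c : ℕ → ℕ → ℝ) (k l : ℕ) : (shB ^ m) c k l = c k (l + m) := by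
  induction m generalizing l with
  | zero => simp
  | succ m ih =>
    rw [pow_succ', Module.End.mul_apply]
    change (shB ^ m) c k (l + 1) = _
    rw [ih]; congr 1; omega

lemma shAB : Commute shA shB := rfl

lemma op_pow (n : ℕ) (p q : ℝ) (c : ℕ → ℕ → ℝ) :
    ((p • shA + (q • shB + (1 - p - q) • (1 : Module.End ℝ (ℕ → ℕ → ℝ)))) ^ n) c 0 0
      = ∑ k ∈ Finset.range (n + 1), ∑ l ∈ Finset.range (n + 1 - k),
          c k l * trinomialPMF n k l p q := by
  have h1 : Commute (p • shA) (q • shB + (1 - p - q) • (1 : Module.End ℝ (ℕ → ℕ → ℝ))) :=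
    ((shAB.smul_left p).smul_right q).add_right ((Commute.one_right _).smul_right _)
  have h2 : Commute (q • shB) ((1 - p - q) • (1 : Module.End ℝ (ℕ → ℕ → ℝ))) :=
    (Commute.one_right _).smul_right _
  rw [h1.add_pow, LinearMap.sum_apply, Finset.sum_apply, Finset.sum_apply]
  refine Finset.sum_congr rfl fun k hk => ?_
  have hk' : k ≤ n := by simpa [Nat.lt_succ_iff] using hk
  rw [h2.add_pow, Finset.mul_sum, Finset.sum_mul, LinearMap.sum_apply, Finset.sum_apply,
    Finset.sum_apply, show n + 1 - k = n - k + 1 by omega]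
  refine Finset.sum_congr rfl fun l hl => ?_
  have hl' : l ≤ n - k := by simpa [Nat.lt_succ_iff] using hl
  have e : (p • shA) ^ k * ((q • shB) ^ l * ((1 - p - q) • (1 : Module.End ℝ (ℕ → ℕ → ℝ))) ^ (n - k - l)
      * ((n - k).choose l : Module.End ℝ (ℕ → ℕ → ℝ))) * (n.choose k : Module.End ℝ (ℕ → ℕ → ℝ))
      = (p ^ k * q ^ l * (1 - p - q) ^ (n - k - l) * ((n - k).choose l : ℝ) * (n.choose k : ℝ))
        • (shA ^ k * shB ^ l) := by
    rw [← nsmul_one ((n - k).choose l), ← nsmul_one (n.choose k)]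
    simp only [← Nat.cast_smul_eq_nsmul ℝ, smul_pow, one_pow, smul_mul_assoc, mul_smul_comm, mul_one,
      smul_smul]
    congr 1; ring
  rw [e]
  simp only [LinearMap.smul_apply, Pi.smul_apply, Module.End.mul_apply, shA_pow, shB_pow, zero_add,
    smul_eq_mul, trinomialPMF]
  rw [Nat.cast_choose ℝ hl', Nat.cast_choose ℝ hk']
  have := Nat.factorial_ne_zero (n - k)
  field_simp

lemma cntLt_le {X : Type} (f : X → ℝ) (n : ℕ) (s : ℝ) (y : Fin n → X) : cntLt f n s y ≤ n := by
  unfold cntLt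
  calc _ ≤ ∑ j : Fin n, 1 := Finset.sum_le_sum fun j _ => by split_ifs <;> simp
    _ = n := by simp

lemma cntEq_le {X : Type} (f : X → ℝ) (n : ℕ) (s : ℝ) (y : Fin n → X) : cntEq f n s y ≤ n := by
  unfold cntEq
  calc _ ≤ ∑ j : Fin n, 1 := Finset.sum_le_sum fun j _ => by split_ifs <;> simp
    _ = n := by simp

lemma bound_c {X : Type} (f : X → ℝ) (n : ℕ) (c : ℕ → ℕ → ℝ) : ∃ M : ℝ, ∀ (s : ℝ) (y : Fin n → X),
    ‖c (cntLt f n s y) (cntEq f n s y)‖ ≤ M := by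
  refine ⟨∑ z ∈ Finset.range (n + 1) ×ˢ Finset.range (n + 1), ‖c z.1 z.2‖, fun s y => ?_⟩
  refine Finset.single_le_sum (f := fun z : ℕ × ℕ => ‖c z.1 z.2‖) (fun _ _ => norm_nonneg _)
    (a := (cntLt f n s y, cntEq f n s y)) ?_
  have := cntLt_le f n s y
  have := cntEq_le f n s y
  simp; omega

lemma meas_joint {X : Type} [MeasurableSpace X] (f : X → ℝ) (hf : Measurable f) (n : ℕ)
    (c : ℕ → ℕ → ℝ) :
    Measurable fun z : X × (Fin n → X) => c (cntLt f n (f z.1) z.2) (cntEq f n (f z.1) z.2) := by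
  have h1 : Measurable fun z : X × (Fin n → X) => cntLt f n (f z.1) z.2 := by
    unfold cntLt
    refine Finset.measurable_sum _ fun j _ => Measurable.ite ?_ measurable_const measurable_const
    exact measurableSet_lt (by fun_prop) (by fun_prop)
  have h2 : Measurable fun z : X × (Fin n → X) => cntEq f n (f z.1) z.2 := by
    unfold cntEq
    refine Finset.measurable_sum _ fun j _ => Measurable.ite ?_ measurable_const measurable_const
    exact measurableSet_eq_fun (by fun_prop) (by fun_prop)
  exact (measurable_of_countable (fun z : ℕ × ℕ => c z.1 z.2)).comp (h1.prodMk h2)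

lemma meas_s {X : Type} [MeasurableSpace X] (f : X → ℝ) (hf : Measurable f) (n : ℕ) (s : ℝ)
    (c : ℕ → ℕ → ℝ) :
    Measurable fun y : Fin n → X => c (cntLt f n s y) (cntEq f n s y) := by
  have h1 : Measurable fun z : (Fin n → X) => cntLt f n s z := by
    unfold cntLt
    refine Finset.measurable_sum _ fun j _ => Measurable.ite ?_ measurable_const measurable_const
    exact measurableSet_lt (by fun_prop) (by fun_prop)
  have h2 : Measurable fun z : (Fin n → X) => cntEq f n s z := by
    unfold cntEq
    refine Finset.measurable_sum _ fun j _ => Measurable.ite ?_ measurable_const measurable_const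
    exact measurableSet_eq_fun (by fun_prop) (by fun_prop)
  exact (measurable_of_countable (fun z : ℕ × ℕ => c z.1 z.2)).comp (h1.prodMk h2)

lemma integral_op {X : Type} [MeasurableSpace X] (P : Measure X) [IsProbabilityMeasure P]
    (f : X → ℝ) (hf : Measurable f) (s : ℝ) (n : ℕ) (c : ℕ → ℕ → ℝ) :
    ∫ y : Fin n → X, c (cntLt f n s y) (cntEq f n s y) ∂(Measure.pi fun _ => P)
     = ((P.real {y | f y < s} • shA + (P.real {y | f y = s} • shB +
        (1 - P.real {y | f y < s} - P.real {y | f y = s}) • (1 : Module.End ℝ (ℕ → ℕ → ℝ)))) ^ n)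
          c 0 0 := by
  induction n generalizing c with
  | zero => simp [cntLt, cntEq]
  | succ n ih =>
    have hmp := (measurePreserving_piFinSuccAbove (fun _ : Fin (n + 1) => P) 0).symm
    rw [← hmp.integral_comp']
    obtain ⟨M, hM⟩ := bound_c f (n + 1) c
    rw [integral_prod]
    swap
    · refine Integrable.of_bound (C := M) ?_ ?_
      · exact ((meas_s f hf (n + 1) s c).comp (MeasurableEquiv.measurable _)).aestronglyMeasurable
      · exact Filter.Eventually.of_forall fun z => hM s _
    have key : ∀ x : X, ∫ y : Fin n → X,
        c (cntLt f (n + 1) s ((MeasurableEquiv.piFinSuccAbove (fun _ => X) 0).symm (x, y)))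
          (cntEq f (n + 1) s ((MeasurableEquiv.piFinSuccAbove (fun _ => X) 0).symm (x, y)))
          ∂(Measure.pi fun _ => P)
        = ({y | f y < s}.indicator (fun _ => (∫ y : Fin n → X, shA c (cntLt f n s y) (cntEq f n s y) ∂(Measure.pi fun _ => P)) - ∫ y : Fin n → X, c (cntLt f n s y) (cntEq f n s y) ∂(Measure.pi fun _ => P)) x
        + {y | f y = s}.indicator (fun _ => (∫ y : Fin n → X, shB c (cntLt f n s y) (cntEq f n s y) ∂(Measure.pi fun _ => P)) - ∫ y : Fin n → X, c (cntLt f n s y) (cntEq f n s y) ∂(Measure.pi fun _ => P)) x)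
        + ∫ y : Fin n → X, c (cntLt f n s y) (cntEq f n s y) ∂(Measure.pi fun _ => P) := by
      intro x
      have e1 : ∀ y : Fin n → X, cntLt f (n + 1) s ((MeasurableEquiv.piFinSuccAbove (fun _ => X) 0).symm (x, y)) = (if f x < s then 1 else 0) + cntLt f n s y := by
        intro y
        unfold cntLt
        rw [Fin.sum_univ_succ]
        simp only [MeasurableEquiv.piFinSuccAbove_symm_apply, Fin.insertNthEquiv_zero,
          Fin.consEquiv_apply, Fin.cons_zero, Fin.cons_succ]
      have e2 : ∀ y : Fin n → X, cntEq f (n + 1) s ((MeasurableEquiv.piFinSuccAbove (fun _ => X) 0).symm (x, y)) = (if f x = s then 1 else 0) + cntEq f n s y := by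
        intro y
        unfold cntEq
        rw [Fin.sum_univ_succ]
        simp only [MeasurableEquiv.piFinSuccAbove_symm_apply, Fin.insertNthEquiv_zero,
          Fin.consEquiv_apply, Fin.cons_zero, Fin.cons_succ]
      simp only [e1, e2]
      rcases lt_trichotomy (f x) s with h | h | h
      · simp [h, h.ne, shA, add_comm]
      · simp [h, shB, add_comm]
      · simp [h.ne', h.not_gt]
    simp only at *
    rw [integral_congr_ae (Filter.Eventually.of_forall key)]
    have m1 : MeasurableSet {y | f y < s} := measurableSet_lt hf measurable_const
    have m2 : MeasurableSet {y | f y = s} := measurableSet_eq_fun hf measurable_const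
    rw [integral_add (((integrable_const _).indicator m1).add ((integrable_const _).indicator m2)) (integrable_const _),
      integral_add ((integrable_const _).indicator m1) ((integrable_const _).indicator m2),
      integral_indicator m1, integral_indicator m2]
    simp only [ih, integral_const, pow_succ, Module.End.mul_apply, LinearMap.add_apply,
      LinearMap.smul_apply, map_add, map_smul, Pi.add_apply, Pi.smul_apply, smul_eq_mul]
    simp
    ring

lemma rankWeight_eq {X : Type} (f : X → ℝ) (n : ℕ) (w : ℕ → ℝ) (i : Fin (n + 1)) (a : X) (y : Fin n → X) :
    rankWeight f (n + 1) w i (i.insertNth a y)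
     = (fun k l : ℕ => ∑ j ∈ Finset.Icc k (k + l), w j / ((l : ℝ) + 1))
        (cntLt f n (f a) y) (cntEq f n (f a) y) := by
  have e1 : (Finset.univ.filter fun j' : Fin (n + 1) => j' ≠ i ∧ f (i.insertNth (α := fun _ => X) a y j') < f (i.insertNth (α := fun _ => X) a y i)).card = cntLt f n (f a) y := by
    rw [Finset.card_filter, Fin.sum_univ_succAbove _ i]
    simp [cntLt]
  have e2 : (Finset.univ.filter fun j' : Fin (n + 1) => j' ≠ i ∧ f (i.insertNth (α := fun _ => X) a y j') = f (i.insertNth (α := fun _ => X) a y i)).card = cntEq f n (f a) y := by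
    rw [Finset.card_filter, Fin.sum_univ_succAbove _ i]
    simp [cntEq]
  unfold rankWeight
  rw [e1, e2, Finset.sum_div]

lemma main_i {X : Type} [MeasurableSpace X] (P : Measure X) [IsProbabilityMeasure P]
    {D : ℕ} (f : X → ℝ) (hf : Measurable f) (n : ℕ) (w : ℕ → ℝ)
    (g : X → EuclideanSpace ℝ (Fin D)) (hg : Integrable g P) (i : Fin (n + 1)) :
    Integrable (fun x : Fin (n + 1) → X => rankWeight f (n + 1) w i x • g (x i))
      (Measure.pi fun _ => P) ∧
    ∫ x : Fin (n + 1) → X, rankWeight f (n + 1) w i x • g (x i) ∂(Measure.pi fun _ => P)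
      = ∫ x : X, (∑ k ∈ Finset.range (n + 1), ∑ l ∈ Finset.range (n + 1 - k),
          (∑ j ∈ Finset.Icc k (k + l), w j / ((l : ℝ) + 1)) *
            trinomialPMF n k l ((P {y | f y < f x}).toReal) ((P {y | f y = f x}).toReal)) • g x ∂P := by
  have hmp := (measurePreserving_piFinSuccAbove (fun _ : Fin (n + 1) => P) i).symm
  have key : ∀ z : X × (Fin n → X),
      (fun x : Fin (n + 1) → X => rankWeight f (n + 1) w i x • g (x i))
        ((MeasurableEquiv.piFinSuccAbove (fun _ => X) i).symm z)
      = (fun k l : ℕ => ∑ j ∈ Finset.Icc k (k + l), w j / ((l : ℝ) + 1))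
        (cntLt f n (f z.1) z.2) (cntEq f n (f z.1) z.2) • g z.1 := by
    rintro ⟨a, y⟩
    have : (MeasurableEquiv.piFinSuccAbove (fun _ => X) i).symm (a, y) = i.insertNth (α := fun _ => X) a y := rfl
    rw [this]
    beta_reduce
    rw [rankWeight_eq, Fin.insertNth_apply_same]
  generalize hc : (fun k l : ℕ => ∑ j ∈ Finset.Icc k (k + l), w j / ((l : ℝ) + 1)) = c at key
  obtain ⟨M, hM⟩ := bound_c f n c
  have hint : Integrable (fun z : X × (Fin n → X) =>
      c (cntLt f n (f z.1) z.2) (cntEq f n (f z.1) z.2) • g z.1)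
      (P.prod (Measure.pi fun _ => P)) := by
    refine Integrable.bdd_smul (hg.comp_fst _) M (meas_joint f hf n c).aestronglyMeasurable ?_
    exact Filter.Eventually.of_forall fun z => hM _ _
  constructor
  · rw [← hmp.integrable_comp_emb (MeasurableEquiv.measurableEmbedding _)]
    exact hint.congr (Filter.Eventually.of_forall fun z => (key z).symm)
  · rw [← hmp.integral_comp', integral_congr_ae (Filter.Eventually.of_forall key)]
    refine (integral_prod _ hint).trans ?_
    refine integral_congr_ae (Filter.Eventually.of_forall fun x => ?_)
    simp only [integral_smul_const]
    rw [integral_op P f hf, op_pow, ← hc]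
    rfl

/-- **Expectation of a rank-weighted sum over i.i.d. samples.**  If `X₁,…,X_λ` are
i.i.d. of law `P` and `W` is the rank-based weight built from the nonincreasing
constants `w₁ ≥ … ≥ w_λ`, then for any `P`-integrable `g` the random vector
`Y = Σᵢ W(i; X₁,…,X_λ) g(Xᵢ)` is integrable and
`E[Y] = ∫ u(q^<(f x), q^=(f x)) g(x) P(dx)`. -/
theorem stmt0 {X : Type} [MeasurableSpace X] (P : Measure X) [IsProbabilityMeasure P]
    {D : ℕ} (f : X → ℝ) (hf : Measurable f)
    (lam : ℕ) (hlam : 2 ≤ lam)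
    (w : ℕ → ℝ) (hw : ∀ i j : ℕ, i ≤ j → j < lam → w j ≤ w i)
    (g : X → EuclideanSpace ℝ (Fin D)) (hg : Integrable g P) :
    Integrable (fun x : Fin lam → X => ∑ i : Fin lam, rankWeight f lam w i x • g (x i))
      (Measure.pi fun _ : Fin lam => P) ∧
    ∫ x : Fin lam → X, ∑ i : Fin lam, rankWeight f lam w i x • g (x i)
        ∂(Measure.pi fun _ : Fin lam => P)
      = ∫ x : X,
          uWeight lam w ((P {y | f y < f x}).toReal) ((P {y | f y = f x}).toReal) • g x ∂P := by
  obtain ⟨n, rfl⟩ : ∃ n, lam = n + 1 := ⟨lam - 1, by omega⟩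
  have h := fun i => main_i P f hf n w g hg i
  refine ⟨integrable_finsetSum _ fun i _ => (h i).1, ?_⟩
  rw [integral_finsetSum _ fun i _ => (h i).1]
  simp only [fun i => (h i).2]
  rw [Finset.sum_const, Finset.card_univ, Fintype.card_fin, ← Nat.cast_smul_eq_nsmul ℝ,
    ← integral_smul]
  congr 1
  funext x
  rw [smul_smul]
  congr 1
  unfold uWeight
  simp only [Finset.mul_sum (Finset.range _), Nat.add_sub_cancel]
  refine Finset.sum_congr rfl fun k _ => Finset.sum_congr rfl fun l _ => ?_
  ring
end

section
/- Suppose conditions A1 and A2 hold. Then the set Λ = {α > 0 : γ_α < 1} is nonempty, and for every α ∈ Λ there exists at least one finite integer N ≥ 1 with (Δ₁(Nα) + Δ₂(α, Nα))^{1/N} = γ_α < 1, i.e., the infimum defining γ_α is attained. -/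
open MeasureTheory Filter

/-- **Nonemptiness of the admissible step-size set and attainment of the rate.**
Under conditions A1 and A2 for the stochastic algorithm `θ_{n+1} = θ_n + α F_n` and its
mean flow `φ`, the set `Λ = {α > 0 : γ_α < 1}` is nonempty, where
`γ_a = inf_{N ≥ 1} (Δ₁(Na) + Δ₂(a, Na))^{1/N}`, and for every `a ∈ Λ` the infimum
defining `γ_a` is attained by some finite `N ≥ 1`. -/
theorem stmt1 {D : ℕ} {Ω : Type} {m0 : MeasurableSpace Ω}
    (μ : Measure Ω) [IsProbabilityMeasure μ]
    (𝔉 : Filtration ℕ m0)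
    (Θ : Set (EuclideanSpace ℝ (Fin D)))
    (θ : ℕ → Ω → EuclideanSpace ℝ (Fin D))
    (Fn : ℕ → Ω → EuclideanSpace ℝ (Fin D))
    (F : EuclideanSpace ℝ (Fin D) → EuclideanSpace ℝ (Fin D))
    (φ : ℝ → EuclideanSpace ℝ (Fin D) → EuclideanSpace ℝ (Fin D))
    (Ψ : EuclideanSpace ℝ (Fin D) → ℝ)
    (α : ℝ) (hα : 0 < α)
    -- the stochastic algorithm, with mean field `F`, adapted to the filtration
    (hrec : ∀ n ω, θ (n + 1) ω = θ n ω + α • Fn n ω)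
    (hadapted : Adapted 𝔉 θ)
    (hmean : ∀ n, μ[Fn n | 𝔉 n] =ᵐ[μ] fun ω => F (θ n ω))
    (hstay : ∀ n, ∀ᵐ ω ∂μ, θ n ω ∈ Θ)
    -- the mean flow
    (hflow0 : ∀ ϑ ∈ Θ, φ 0 ϑ = ϑ)
    (hflowInt : ∀ ϑ ∈ Θ, ∀ t : ℝ, 0 ≤ t →
      IntervalIntegrable (fun τ => F (φ τ ϑ)) volume 0 t)
    (hflow : ∀ ϑ ∈ Θ, ∀ t : ℝ, 0 ≤ t → φ t ϑ = ϑ + ∫ τ in (0:ℝ)..t, F (φ τ ϑ))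
    (hflowstay : ∀ ϑ ∈ Θ, ∀ t : ℝ, 0 ≤ t → φ t ϑ ∈ Θ)
    (hΨnonneg : ∀ ϑ ∈ Θ, 0 ≤ Ψ ϑ)
    -- condition A1
    (Δ₁ : ℝ → ℝ)
    (hΔ₁nonneg : ∀ t : ℝ, 0 ≤ t → 0 ≤ Δ₁ t)
    (hΔ₁anti : AntitoneOn Δ₁ (Set.Ici 0))
    (hΔ₁lim : Tendsto Δ₁ atTop (nhds 0))
    (hA1 : ∀ ϑ ∈ Θ, ∀ t : ℝ, 0 ≤ t → Ψ (φ t ϑ) ≤ Δ₁ t * Ψ ϑ)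
    -- condition A2
    (Δ₂ : ℝ → ℝ → ℝ)
    (hΔ₂pos : ∀ a T : ℝ, 0 < a → 0 < T → 0 < Δ₂ a T)
    (hΔ₂mono₁ : ∀ T : ℝ, 0 < T → MonotoneOn (fun a => Δ₂ a T) (Set.Ioi 0))
    (hΔ₂mono₂ : ∀ a : ℝ, 0 < a → MonotoneOn (Δ₂ a) (Set.Ioi 0))
    (hΔ₂lim : ∀ T : ℝ, 0 < T →
      Tendsto (fun a => Δ₂ a T) (nhdsWithin 0 (Set.Ioi 0)) (nhds 0))
    (hA2 : ∀ n N : ℕ, 1 ≤ N → ∀ᵐ ω ∂μ,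
      (μ[fun ω' => Ψ (θ (n + N) ω') | 𝔉 n]) ω
        ≤ Ψ (φ ((N : ℝ) * α) (θ n ω)) + Δ₂ α ((N : ℝ) * α) * Ψ (θ n ω))
    -- the convergence-rate function
    (γ : ℝ → ℝ)
    (hγ : ∀ a : ℝ, γ a =
      ⨅ N : ℕ+, (Δ₁ (((N : ℕ) : ℝ) * a) + Δ₂ a (((N : ℕ) : ℝ) * a)) ^ ((1:ℝ) / ((N : ℕ) : ℝ))) :
    (∃ a : ℝ, 0 < a ∧ γ a < 1) ∧
    (∀ a : ℝ, 0 < a → γ a < 1 →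
      ∃ N : ℕ+,
        (Δ₁ (((N : ℕ) : ℝ) * a) + Δ₂ a (((N : ℕ) : ℝ) * a)) ^ ((1:ℝ) / ((N : ℕ) : ℝ)) = γ a) := by
  have hnn : ∀ a : ℝ, 0 < a → ∀ N : ℕ+,
      0 < Δ₁ (((N : ℕ) : ℝ) * a) + Δ₂ a (((N : ℕ) : ℝ) * a) := by
    intro a ha N
    have hN : (0:ℝ) < ((N : ℕ) : ℝ) := by exact_mod_cast N.pos
    have h1 := hΔ₁nonneg _ (mul_pos hN ha).le
    have h2 := hΔ₂pos a _ ha (mul_pos hN ha)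
    linarith
  have hbdd : ∀ a : ℝ, 0 < a → BddBelow (Set.range fun N : ℕ+ =>
      (Δ₁ (((N : ℕ) : ℝ) * a) + Δ₂ a (((N : ℕ) : ℝ) * a)) ^ ((1:ℝ) / ((N : ℕ) : ℝ))) := by
    intro a ha
    refine ⟨0, ?_⟩
    rintro _ ⟨N, rfl⟩
    exact Real.rpow_nonneg (hnn a ha N).le _
  constructor
  · obtain ⟨T, hT1, hT⟩ := ((hΔ₁lim.eventually (gt_mem_nhds (show (0:ℝ) < 1/2 by norm_num))).and
      (eventually_gt_atTop 0)).exists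
    have hseq : Tendsto (fun n : ℕ => T / ((n : ℝ) + 1)) atTop (nhdsWithin 0 (Set.Ioi 0)) := by
      refine tendsto_nhdsWithin_iff.2 ⟨?_, Eventually.of_forall fun n => ?_⟩
      · have := (tendsto_one_div_add_atTop_nhds_zero_nat (𝕜 := ℝ)).const_mul T
        simpa [div_eq_mul_inv] using this
      · exact div_pos hT (by positivity)
    obtain ⟨n, hn⟩ := (((hΔ₂lim T hT).comp hseq).eventually
      (gt_mem_nhds (show (0:ℝ) < 1/2 by norm_num))).exists
    have ha : 0 < T / ((n : ℝ) + 1) := by positivity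
    refine ⟨T / ((n : ℝ) + 1), ha, ?_⟩
    rw [hγ]
    refine (ciInf_le (hbdd _ ha) n.succPNat).trans_lt ?_
    refine Real.rpow_lt_one (hnn _ ha _).le ?_ (by positivity)
    have e : ((n.succPNat : ℕ) : ℝ) * (T / ((n : ℝ) + 1)) = T := by
      rw [Nat.succPNat_coe]; push_cast; field_simp
    rw [e]
    simp only [Function.comp] at hn
    linarith
  · intro a ha hlt
    rw [hγ] at hlt ⊢
    set f : ℕ+ → ℝ := fun N =>
      (Δ₁ (((N : ℕ) : ℝ) * a) + Δ₂ a (((N : ℕ) : ℝ) * a)) ^ ((1:ℝ) / ((N : ℕ) : ℝ)) with hf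
    change iInf f < 1 at hlt
    change ∃ N, f N = iInf f
    obtain ⟨N0, hN0⟩ := exists_lt_of_ciInf_lt hlt
    have hc : 0 < Δ₂ a a := hΔ₂pos a a ha ha
    have hlim : Tendsto (fun n : ℕ => Δ₂ a a ^ ((1:ℝ) / (n : ℝ))) atTop (nhds 1) := by
      have := (tendsto_const_nhds (x := Δ₂ a a)).rpow
        (tendsto_one_div_atTop_nhds_zero_nat (𝕜 := ℝ)) (Or.inl hc.ne')
      simpa using this
    obtain ⟨M, hM⟩ := eventually_atTop.1 (hlim.eventually (lt_mem_nhds hN0))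
    have hbig : ∀ N : ℕ+, M ≤ (N : ℕ) → f N0 < f N := by
      intro N hN
      refine (hM N hN).trans_le ?_
      have h1N : (1:ℝ) ≤ ((N : ℕ) : ℝ) := by exact_mod_cast N.one_le
      have haN : a ≤ ((N : ℕ) : ℝ) * a := by nlinarith
      have h1 := hΔ₁nonneg (((N : ℕ) : ℝ) * a) (ha.le.trans haN)
      have h2 := hΔ₂mono₂ a ha (Set.mem_Ioi.2 ha) (Set.mem_Ioi.2 (ha.trans_le haN)) haN
      exact Real.rpow_le_rpow hc.le (by linarith) (by positivity)
    obtain ⟨K, hK, hmin⟩ := Finset.exists_min_image (Finset.Iic (N0 + M.succPNat)) f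
      ⟨N0, Finset.mem_Iic.2 (PNat.lt_add_right _ _).le⟩
    have hall : ∀ N, f K ≤ f N := by
      intro N
      by_cases hN : N ≤ N0 + M.succPNat
      · exact hmin N (Finset.mem_Iic.2 hN)
      · have h3 : M ≤ (N : ℕ) := by
          have h4 : ((N0 + M.succPNat : ℕ+) : ℕ) < (N : ℕ) := by exact_mod_cast not_le.1 hN
          rw [PNat.add_coe, Nat.succPNat_coe] at h4
          omega
        exact (hmin N0 (Finset.mem_Iic.2 (PNat.lt_add_right _ _).le)).trans (hbig N h3).le
    exact ⟨K, le_antisymm (le_ciInf hall) (ciInf_le (hbdd a ha) K)⟩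
end

section
/- Suppose there is an open U ⊆ Θ with {θ : Ψ(θ) < ζ} ⊆ U for some ζ > 0, and conditions A3 and A4 hold. Let γ_α, Λ, N*_α be as defined; fix α ∈ Λ, θ₀ ∈ U, and let Ω_k = ⋂_{i=0}^{k} [θ_{i N*_α} ∈ U] and Ω_∞ = lim_{k→∞} Ω_k. Then for every k ≥ 0, Pr[Ω_k] ≥ 1 − (Ψ(θ₀)/ζ) · (γ_α^{N*_α} − γ_α^{N*_α (k+1)})/(1 − γ_α^{N*_α}), and Pr[Ω_∞] ≥ 1 − (Ψ(θ₀)/ζ) · γ_α^{N*_α}/(1 − γ_α^{N*_α}). -/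
open MeasureTheory Filter

/-- **Probability of remaining in the basin of attraction (Theorem 6.1 (1)).**
Under the local conditions A3 and A4 on an open set `U ⊇ {Ψ < ζ}`, for `α ∈ Λ`,
`θ₀ ∈ U`, and `Ω_k = ⋂_{i=0}^k [θ_{i N*_α} ∈ U]`, one has
`Pr[Ω_k] ≥ 1 − (Ψ(θ₀)/ζ)(γ_α^{N*} − γ_α^{N*(k+1)})/(1 − γ_α^{N*})` and
`Pr[Ω_∞] ≥ 1 − (Ψ(θ₀)/ζ) γ_α^{N*}/(1 − γ_α^{N*})`. -/
theorem stmt11 {D : ℕ} {Ω : Type} {m0 : MeasurableSpace Ω}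
    (μ : Measure Ω) [IsProbabilityMeasure μ]
    (𝔉 : Filtration ℕ m0)
    (Θ U : Set (EuclideanSpace ℝ (Fin D)))
    (hUopen : IsOpen U) (hUΘ : U ⊆ Θ)
    (θ : ℕ → Ω → EuclideanSpace ℝ (Fin D))
    (Fn : ℕ → Ω → EuclideanSpace ℝ (Fin D))
    (F : EuclideanSpace ℝ (Fin D) → EuclideanSpace ℝ (Fin D))
    (φ : ℝ → EuclideanSpace ℝ (Fin D) → EuclideanSpace ℝ (Fin D))
    (Ψ : EuclideanSpace ℝ (Fin D) → ℝ)
    (α : ℝ) (hα : 0 < α)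
    -- the stochastic algorithm, with mean field `F`, adapted to the filtration
    (hrec : ∀ n ω, θ (n + 1) ω = θ n ω + α • Fn n ω)
    (hadapted : Adapted 𝔉 θ)
    (hmean : ∀ n, μ[Fn n | 𝔉 n] =ᵐ[μ] fun ω => F (θ n ω))
    (hstay : ∀ n, ∀ᵐ ω ∂μ, θ n ω ∈ Θ)
    -- deterministic initialization in `U`
    (θ₀ : EuclideanSpace ℝ (Fin D)) (hθ₀U : θ₀ ∈ U) (hθ₀ : ∀ ω, θ 0 ω = θ₀)
    -- the mean flow
    (hflow0 : ∀ ϑ ∈ Θ, φ 0 ϑ = ϑ)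
    (hflowInt : ∀ ϑ ∈ Θ, ∀ t : ℝ, 0 ≤ t →
      IntervalIntegrable (fun τ => F (φ τ ϑ)) volume 0 t)
    (hflow : ∀ ϑ ∈ Θ, ∀ t : ℝ, 0 ≤ t → φ t ϑ = ϑ + ∫ τ in (0:ℝ)..t, F (φ τ ϑ))
    (hflowstay : ∀ ϑ ∈ Θ, ∀ t : ℝ, 0 ≤ t → φ t ϑ ∈ Θ)
    (hΨnonneg : ∀ ϑ ∈ Θ, 0 ≤ Ψ ϑ)
    (hΨint : ∀ n, Integrable (fun ω => Ψ (θ n ω)) μ)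
    -- the sublevel set `{Ψ < ζ}` is contained in `U`
    (ζ : ℝ) (hζ : 0 < ζ) (hζU : {ϑ | ϑ ∈ Θ ∧ Ψ ϑ < ζ} ⊆ U)
    -- condition A3
    (Δ₃ : ℝ → ℝ)
    (hΔ₃nonneg : ∀ t : ℝ, 0 ≤ t → 0 ≤ Δ₃ t)
    (hΔ₃anti : AntitoneOn Δ₃ (Set.Ici 0))
    (hΔ₃lim : Tendsto Δ₃ atTop (nhds 0))
    (hA3 : ∀ ϑ ∈ U, ∀ t : ℝ, 0 ≤ t → Ψ (φ t ϑ) ≤ Δ₃ t * Ψ ϑ)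
    -- condition A4
    (Δ₄ : ℝ → ℝ → ℝ)
    (hΔ₄pos : ∀ a T : ℝ, 0 < a → 0 < T → 0 < Δ₄ a T)
    (hΔ₄mono₁ : ∀ T : ℝ, 0 < T → MonotoneOn (fun a => Δ₄ a T) (Set.Ioi 0))
    (hΔ₄mono₂ : ∀ a : ℝ, 0 < a → MonotoneOn (Δ₄ a) (Set.Ioi 0))
    (hΔ₄lim : ∀ T : ℝ, 0 < T →
      Tendsto (fun a => Δ₄ a T) (nhdsWithin 0 (Set.Ioi 0)) (nhds 0))
    (hA4 : ∀ n N : ℕ, 1 ≤ N → ∀ᵐ ω ∂μ, θ n ω ∈ U →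
      (μ[fun ω' => Ψ (θ (n + N) ω') | 𝔉 n]) ω
        ≤ Ψ (φ ((N : ℝ) * α) (θ n ω)) + Δ₄ α ((N : ℝ) * α) * Ψ (θ n ω))
    -- the convergence rate `γ_α` and the step size `α ∈ Λ`
    (γα : ℝ)
    (hγα : γα =
      ⨅ N : ℕ+, (Δ₃ (((N : ℕ) : ℝ) * α) + Δ₄ α (((N : ℕ) : ℝ) * α)) ^ ((1:ℝ) / ((N : ℕ) : ℝ)))
    (hαΛ : γα < 1)
    -- `N*_α`: the smallest `N ≥ 1` attaining the infimum
    (Nstar : ℕ+)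
    (hNstar : (Δ₃ (((Nstar : ℕ) : ℝ) * α) + Δ₄ α (((Nstar : ℕ) : ℝ) * α))
        ^ ((1:ℝ) / ((Nstar : ℕ) : ℝ)) = γα)
    (hNstarMin : ∀ M : ℕ+,
      (Δ₃ (((M : ℕ) : ℝ) * α) + Δ₄ α (((M : ℕ) : ℝ) * α)) ^ ((1:ℝ) / ((M : ℕ) : ℝ)) = γα →
      Nstar ≤ M) :
    (∀ k : ℕ,
      1 - (Ψ θ₀ / ζ) *
          ((γα ^ (Nstar : ℕ) - γα ^ ((Nstar : ℕ) * (k + 1))) / (1 - γα ^ (Nstar : ℕ)))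
        ≤ (μ {ω | ∀ i ≤ k, θ (i * (Nstar : ℕ)) ω ∈ U}).toReal) ∧
    1 - (Ψ θ₀ / ζ) * (γα ^ (Nstar : ℕ) / (1 - γα ^ (Nstar : ℕ)))
      ≤ (μ {ω | ∀ i : ℕ, θ (i * (Nstar : ℕ)) ω ∈ U}).toReal := by
  have hNpos : 0 < (Nstar : ℕ) := Nstar.pos
  generalize hN : (Nstar : ℕ) = N at *
  have hNα : 0 < (N : ℝ) * α := by positivity
  have hq0 : 0 < Δ₃ ((N : ℝ) * α) + Δ₄ α ((N : ℝ) * α) :=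
    add_pos_of_nonneg_of_pos (hΔ₃nonneg _ hNα.le) (hΔ₄pos _ _ hα hNα)
  have hγ0 : 0 < γα := by rw [← hNstar]; exact Real.rpow_pos_of_pos hq0 _
  have hq : γα ^ N = Δ₃ ((N : ℝ) * α) + Δ₄ α ((N : ℝ) * α) := by
    rw [← hNstar, one_div]
    exact Real.rpow_inv_natCast_pow hq0.le hNpos.ne'
  have hq1 : γα ^ N < 1 := pow_lt_one₀ hγ0.le hαΛ hNpos.ne'
  rw [← hq] at hq0
  simp only [pow_mul]
  generalize γα ^ N = q at *
  set S : ℕ → Set Ω := fun k => {ω | ∀ i ≤ k, θ (i * N) ω ∈ U} with hS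
  have hSsub : ∀ k, S (k + 1) ⊆ S k := fun k ω h i hi => h i (by omega)
  have hSm : ∀ k, MeasurableSet[𝔉 (k * N)] (S k) := by
    intro k
    have : S k = ⋂ i ∈ Set.Iic k, (θ (i * N)) ⁻¹' U := by
      ext ω; simp [hS]
    rw [this]
    refine MeasurableSet.biInter (Set.to_countable _) fun i hi => ?_
    exact 𝔉.mono (Nat.mul_le_mul_right N hi) _ (hadapted (i * N) hUopen.measurableSet)
  have hSm0 : ∀ k, MeasurableSet (S k) := fun k => 𝔉.le _ _ (hSm k)
  have hnn : ∀ n, ∀ᵐ ω ∂μ, 0 ≤ Ψ (θ n ω) := fun n => by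
    filter_upwards [hstay n] with ω h using hΨnonneg _ h
  have hstep : ∀ k, ∫ ω in S k, Ψ (θ ((k + 1) * N) ω) ∂μ ≤ q * ∫ ω in S k, Ψ (θ (k * N) ω) ∂μ := by
    intro k
    have e : (k + 1) * N = k * N + N := by ring
    rw [e, ← setIntegral_condExp (𝔉.le (k * N)) (hΨint (k * N + N)) (hSm k), ← integral_const_mul]
    refine setIntegral_mono_ae_restrict integrable_condExp.integrableOn
      ((hΨint _).const_mul _).integrableOn ?_
    refine (ae_restrict_iff' (hSm0 k)).2 ?_
    filter_upwards [hA4 (k * N) N hNpos] with ω h hω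
    have hU : θ (k * N) ω ∈ U := hω k le_rfl
    have h1 := h hU
    have h2 := hA3 _ hU _ hNα.le
    rw [hq]
    linarith
  have hE : ∀ k, ∫ ω in S k, Ψ (θ ((k + 1) * N) ω) ∂μ ≤ q ^ (k + 1) * Ψ θ₀ := by
    intro k
    induction k with
    | zero =>
      have hS0 : S 0 = Set.univ := by ext ω; simp [hS, hθ₀, hθ₀U]
      have := hstep 0
      simpa [hS0, hθ₀] using this
    | succ k ih =>
      refine (hstep (k + 1)).trans ?_
      rw [pow_succ' q (k + 1), mul_assoc]
      refine mul_le_mul_of_nonneg_left (le_trans ?_ ih) hq0.le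
      exact setIntegral_mono_set (hΨint _).integrableOn (ae_restrict_of_ae (hnn _))
        (hSsub k).eventuallyLE
  have hdiff : ∀ k, μ.real (S k) - μ.real (S (k + 1)) ≤ Ψ θ₀ / ζ * q ^ (k + 1) := by
    intro k
    have hd : MeasurableSet (S k \ S (k + 1)) := (hSm0 k).diff (hSm0 (k + 1))
    rw [← measureReal_sdiff (hSsub k) (hSm0 (k + 1))]
    have h1 : ζ * μ.real (S k \ S (k + 1)) ≤
        ∫ ω in S k \ S (k + 1), Ψ (θ ((k + 1) * N) ω) ∂μ := by
      have hc : ∫ _ω in S k \ S (k + 1), ζ ∂μ = ζ * μ.real (S k \ S (k + 1)) := by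
        rw [setIntegral_const, smul_eq_mul, mul_comm]
      rw [← hc]
      refine setIntegral_mono_ae_restrict (integrable_const _).integrableOn
        (hΨint _).integrableOn ((ae_restrict_iff' hd).2 ?_)
      filter_upwards [hstay ((k + 1) * N)] with ω hω hmem
      by_contra hlt
      refine hmem.2 fun i hi => ?_
      rcases Nat.lt_or_ge i (k + 1) with h | h
      · exact hmem.1 i (by omega)
      · obtain rfl : i = k + 1 := le_antisymm hi h
        exact hζU ⟨hω, not_le.1 hlt⟩
    have h2 : ∫ ω in S k \ S (k + 1), Ψ (θ ((k + 1) * N) ω) ∂μ ≤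
        ∫ ω in S k, Ψ (θ ((k + 1) * N) ω) ∂μ :=
      setIntegral_mono_set (hΨint _).integrableOn (ae_restrict_of_ae (hnn _))
        Set.sdiff_subset.eventuallyLE
    have h3 := h1.trans (h2.trans (hE k))
    rw [div_mul_eq_mul_div, le_div_iff₀ hζ]
    linarith
  have hΨ0 : 0 ≤ Ψ θ₀ / ζ := div_nonneg (hΨnonneg _ (hUΘ hθ₀U)) hζ.le
  have hq1' : 0 < 1 - q := by linarith
  have hk : ∀ k, 1 - (Ψ θ₀ / ζ) * ((q - q ^ (k + 1)) / (1 - q)) ≤ μ.real (S k) := by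
    intro k
    induction k with
    | zero =>
      have hS0 : S 0 = Set.univ := by ext ω; simp [hS, hθ₀, hθ₀U]
      simp [hS0]
    | succ k ih =>
      have h := hdiff k
      have e : (q - q ^ (k + 1 + 1)) / (1 - q) = (q - q ^ (k + 1)) / (1 - q) + q ^ (k + 1) := by
        field_simp; ring
      rw [e, mul_add]
      linarith
  refine ⟨hk, ?_⟩
  have hanti : Antitone S := antitone_nat_of_succ_le hSsub
  have hlim := tendsto_measure_iInter_atTop (μ := μ) (fun k => (hSm0 k).nullMeasurableSet) hanti
    ⟨0, measure_ne_top _ _⟩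
  have hinter : (⋂ k, S k) = {ω | ∀ i : ℕ, θ (i * N) ω ∈ U} := by
    ext ω
    simp only [hS, Set.mem_iInter, Set.mem_ofPred_eq]
    exact ⟨fun h i => h i i le_rfl, fun h k i _ => h i⟩
  rw [hinter] at hlim
  have hlim' := (ENNReal.tendsto_toReal (measure_ne_top μ _)).comp hlim
  refine ge_of_tendsto hlim' (Eventually.of_forall fun k => le_trans ?_ (hk k))
  have : (q - q ^ (k + 1)) / (1 - q) ≤ q / (1 - q) := by
    gcongr
    have := pow_pos hq0 (k + 1)
    linarith
  have := mul_le_mul_of_nonneg_left this hΨ0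
  linarith
end

section
/- Under the local conditions (open U ⊆ Θ with {Ψ < ζ} ⊆ U, A3, A4), with α ∈ Λ, θ₀ ∈ U, events Ω_k = ⋂_{i=0}^{k} [θ_{i N*_α} ∈ U], and γ̄_α = 1 if N*_α = 1, else γ̄_α = max_{1 ≤ N ≤ N*_α − 1}(Δ₃(Nα) + Δ₄(α, Nα)), the following holds: E[Ψ(θ_n) · 1_{Ω_{⌊(n−1)/N*_α⌋}}] ≤ (γ̄_α / γ_α^{N*_α − 1}) γ_α^n Ψ(θ₀) for all n ≥ 1. -/
open MeasureTheory Filter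

/-- **Geometric decrease of `E[Ψ(θ_n) 1_{Ω_{⌊(n−1)/N*⌋}}]` (Theorem 6.1 (2)).**
Under the local conditions A3 and A4 on an open set `U ⊇ {Ψ < ζ}`, for `α ∈ Λ` and
`θ₀ ∈ U`, with `Ω_k = ⋂_{i=0}^k [θ_{i N*_α} ∈ U]`,
`E[Ψ(θ_n) 1_{Ω_{⌊(n−1)/N*_α⌋}}] ≤ (γ̄_α/γ_α^{N*_α−1}) γ_α^n Ψ(θ₀)` for all `n ≥ 1`. -/
theorem stmt12 {D : ℕ} {Ω : Type} {m0 : MeasurableSpace Ω}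
    (μ : Measure Ω) [IsProbabilityMeasure μ]
    (𝔉 : Filtration ℕ m0)
    (Θ U : Set (EuclideanSpace ℝ (Fin D)))
    (hUopen : IsOpen U) (hUΘ : U ⊆ Θ)
    (θ : ℕ → Ω → EuclideanSpace ℝ (Fin D))
    (Fn : ℕ → Ω → EuclideanSpace ℝ (Fin D))
    (F : EuclideanSpace ℝ (Fin D) → EuclideanSpace ℝ (Fin D))
    (φ : ℝ → EuclideanSpace ℝ (Fin D) → EuclideanSpace ℝ (Fin D))
    (Ψ : EuclideanSpace ℝ (Fin D) → ℝ)
    (α : ℝ) (hα : 0 < α)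
    -- the stochastic algorithm, with mean field `F`, adapted to the filtration
    (hrec : ∀ n ω, θ (n + 1) ω = θ n ω + α • Fn n ω)
    (hadapted : Adapted 𝔉 θ)
    (hmean : ∀ n, μ[Fn n | 𝔉 n] =ᵐ[μ] fun ω => F (θ n ω))
    (hstay : ∀ n, ∀ᵐ ω ∂μ, θ n ω ∈ Θ)
    -- deterministic initialization in `U`
    (θ₀ : EuclideanSpace ℝ (Fin D)) (hθ₀U : θ₀ ∈ U) (hθ₀ : ∀ ω, θ 0 ω = θ₀)
    -- the mean flow
    (hflow0 : ∀ ϑ ∈ Θ, φ 0 ϑ = ϑ)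
    (hflowInt : ∀ ϑ ∈ Θ, ∀ t : ℝ, 0 ≤ t →
      IntervalIntegrable (fun τ => F (φ τ ϑ)) volume 0 t)
    (hflow : ∀ ϑ ∈ Θ, ∀ t : ℝ, 0 ≤ t → φ t ϑ = ϑ + ∫ τ in (0:ℝ)..t, F (φ τ ϑ))
    (hflowstay : ∀ ϑ ∈ Θ, ∀ t : ℝ, 0 ≤ t → φ t ϑ ∈ Θ)
    (hΨnonneg : ∀ ϑ ∈ Θ, 0 ≤ Ψ ϑ)
    (hΨint : ∀ n, Integrable (fun ω => Ψ (θ n ω)) μ)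
    -- the sublevel set `{Ψ < ζ}` is contained in `U`
    (ζ : ℝ) (hζ : 0 < ζ) (hζU : {ϑ | ϑ ∈ Θ ∧ Ψ ϑ < ζ} ⊆ U)
    -- condition A3
    (Δ₃ : ℝ → ℝ)
    (hΔ₃nonneg : ∀ t : ℝ, 0 ≤ t → 0 ≤ Δ₃ t)
    (hΔ₃anti : AntitoneOn Δ₃ (Set.Ici 0))
    (hΔ₃lim : Tendsto Δ₃ atTop (nhds 0))
    (hA3 : ∀ ϑ ∈ U, ∀ t : ℝ, 0 ≤ t → Ψ (φ t ϑ) ≤ Δ₃ t * Ψ ϑ)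
    -- condition A4
    (Δ₄ : ℝ → ℝ → ℝ)
    (hΔ₄pos : ∀ a T : ℝ, 0 < a → 0 < T → 0 < Δ₄ a T)
    (hΔ₄mono₁ : ∀ T : ℝ, 0 < T → MonotoneOn (fun a => Δ₄ a T) (Set.Ioi 0))
    (hΔ₄mono₂ : ∀ a : ℝ, 0 < a → MonotoneOn (Δ₄ a) (Set.Ioi 0))
    (hΔ₄lim : ∀ T : ℝ, 0 < T →
      Tendsto (fun a => Δ₄ a T) (nhdsWithin 0 (Set.Ioi 0)) (nhds 0))
    (hA4 : ∀ n N : ℕ, 1 ≤ N → ∀ᵐ ω ∂μ, θ n ω ∈ U →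
      (μ[fun ω' => Ψ (θ (n + N) ω') | 𝔉 n]) ω
        ≤ Ψ (φ ((N : ℝ) * α) (θ n ω)) + Δ₄ α ((N : ℝ) * α) * Ψ (θ n ω))
    -- the convergence rate `γ_α` and the step size `α ∈ Λ`
    (γα : ℝ)
    (hγα : γα =
      ⨅ N : ℕ+, (Δ₃ (((N : ℕ) : ℝ) * α) + Δ₄ α (((N : ℕ) : ℝ) * α)) ^ ((1:ℝ) / ((N : ℕ) : ℝ)))
    (hαΛ : γα < 1)
    -- `N*_α`: the smallest `N ≥ 1` attaining the infimum
    (Nstar : ℕ+)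
    (hNstar : (Δ₃ (((Nstar : ℕ) : ℝ) * α) + Δ₄ α (((Nstar : ℕ) : ℝ) * α))
        ^ ((1:ℝ) / ((Nstar : ℕ) : ℝ)) = γα)
    (hNstarMin : ∀ M : ℕ+,
      (Δ₃ (((M : ℕ) : ℝ) * α) + Δ₄ α (((M : ℕ) : ℝ) * α)) ^ ((1:ℝ) / ((M : ℕ) : ℝ)) = γα →
      Nstar ≤ M)
    -- `γ̄_α`
    (γbar : ℝ)
    (hγbar1 : (Nstar : ℕ) = 1 → γbar = 1)
    (hγbar2 : 1 < (Nstar : ℕ) →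
      (∀ N : ℕ, 1 ≤ N → N < (Nstar : ℕ) →
        Δ₃ ((N : ℝ) * α) + Δ₄ α ((N : ℝ) * α) ≤ γbar) ∧
      (∃ N : ℕ, 1 ≤ N ∧ N < (Nstar : ℕ) ∧
        γbar = Δ₃ ((N : ℝ) * α) + Δ₄ α ((N : ℝ) * α))) :
    ∀ n : ℕ, 1 ≤ n →
      ∫ ω in {ω | ∀ i ≤ (n - 1) / (Nstar : ℕ), θ (i * (Nstar : ℕ)) ω ∈ U},
          Ψ (θ n ω) ∂μ
        ≤ (γbar / γα ^ ((Nstar : ℕ) - 1)) * γα ^ n * Ψ θ₀ := by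
  classical
  set c : ℕ → ℝ := fun N => Δ₃ ((N : ℝ) * α) + Δ₄ α ((N : ℝ) * α) with hc
  have hcpos : ∀ N : ℕ, 1 ≤ N → 0 < c N := by
    intro N hN
    have hN' : (0:ℝ) < (N:ℝ) * α := by
      have : (0:ℝ) < (N:ℝ) := by exact_mod_cast hN
      positivity
    have h1 := hΔ₃nonneg _ hN'.le
    have h2 := hΔ₄pos α _ hα hN'
    simp only [hc]; linarith
  set K : ℕ := (Nstar : ℕ) with hK
  have hK1 : 1 ≤ K := Nstar.pos
  have hNs : (c K) ^ ((1:ℝ) / (K:ℝ)) = γα := hNstar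
  have hgpos : 0 < γα := by
    rw [← hNs]; exact Real.rpow_pos_of_pos (hcpos K hK1) _
  have hrt : ∀ N : ℕ, 1 ≤ N → ((c N) ^ ((1:ℝ) / (N:ℝ))) ^ N = c N := by
    intro N hN
    rw [one_div]
    exact Real.rpow_inv_natCast_pow (hcpos N hN).le (by omega)
  have hcK : c K = γα ^ K := by rw [← hNs, hrt K hK1]
  have hlow : ∀ N : ℕ, 1 ≤ N → γα ^ N ≤ c N := by
    intro N hN
    rw [← hrt N hN]
    refine pow_le_pow_left₀ hgpos.le ?_ N
    rw [hγα]
    have hb : BddBelow (Set.range fun N : ℕ+ =>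
        (Δ₃ (((N : ℕ) : ℝ) * α) + Δ₄ α (((N : ℕ) : ℝ) * α)) ^ ((1:ℝ) / ((N : ℕ) : ℝ))) := by
      refine ⟨0, ?_⟩
      rintro _ ⟨M, rfl⟩
      exact Real.rpow_nonneg (hcpos (M:ℕ) M.pos).le _
    exact ciInf_le hb (⟨N, hN⟩ : ℕ+)
  have harith : ∀ r : ℕ, 1 ≤ r → r ≤ K → c r * γα ^ (K - 1) ≤ γbar * γα ^ r := by
    intro r hr hrK
    rcases Nat.lt_or_ge 1 K with h1 | h1
    · obtain ⟨hb, -⟩ := hγbar2 h1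
      rcases Nat.lt_or_ge r K with h2 | h2
      · have h3 : c r ≤ γbar := hb r hr h2
        have h4 : γα ^ (K - 1) ≤ γα ^ r :=
          pow_le_pow_of_le_one hgpos.le hαΛ.le (by omega)
        exact mul_le_mul h3 h4 (by positivity) ((hcpos r hr).le.trans h3)
      · have h3 : r = K := le_antisymm hrK h2
        rw [h3]
        have h4 : c (K - 1) ≤ γbar := hb (K - 1) (by omega) (by omega)
        have h5 := (hlow (K - 1) (by omega)).trans h4
        rw [hcK, mul_comm]
        exact mul_le_mul_of_nonneg_right h5 (by positivity)
    · have h3 : K = 1 := le_antisymm h1 hK1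
      have h4 : r = K := by omega
      rw [h4, hcK, hγbar1 h3, h3]; simp
  -- one block step
  have hstep : ∀ (m N : ℕ) (s : Set Ω), 1 ≤ N → MeasurableSet[𝔉 m] s →
      (∀ ω ∈ s, θ m ω ∈ U) →
      ∫ ω in s, Ψ (θ (m + N) ω) ∂μ ≤ c N * ∫ ω in s, Ψ (θ m ω) ∂μ := by
    intro m N s hN hs hsU
    rw [← setIntegral_condExp (𝔉.le m) (hΨint (m + N)) hs, ← integral_const_mul]
    refine setIntegral_mono_on_ae integrable_condExp.integrableOn
      ((hΨint m).const_mul _).integrableOn (𝔉.le m _ hs) ?_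
    filter_upwards [hA4 m N hN] with ω hω hωs
    have h1 := hω (hsU ω hωs)
    have h2 := hA3 _ (hsU ω hωs) ((N:ℝ) * α) (by positivity)
    simp only [hc]
    linarith
  have hmeas : ∀ k, MeasurableSet[𝔉 (k * K)] {ω | ∀ i ≤ k, θ (i * K) ω ∈ U} := by
    intro k
    have : {ω | ∀ i ≤ k, θ (i * K) ω ∈ U} = ⋂ i ∈ Set.Iic k, (θ (i * K)) ⁻¹' U := by
      ext ω; simp
    rw [this]
    refine MeasurableSet.biInter (Set.to_countable _) ?_
    intro i hi
    have hi' : i * K ≤ k * K := Nat.mul_le_mul_right _ hi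
    exact 𝔉.mono hi' _ ((hadapted (i * K)) hUopen.measurableSet)
  have hblock : ∀ k : ℕ, ∫ ω in {ω | ∀ i ≤ k, θ (i * K) ω ∈ U}, Ψ (θ (k * K) ω) ∂μ
      ≤ γα ^ (k * K) * Ψ θ₀ := by
    intro k
    induction k with
    | zero =>
      have : {ω | ∀ i ≤ 0, θ (i * K) ω ∈ U} = Set.univ := by
        ext ω; simp [hθ₀, hθ₀U]
      rw [this]
      simp [hθ₀]
    | succ k ih =>
      have hsub : {ω | ∀ i ≤ k + 1, θ (i * K) ω ∈ U} ⊆ {ω | ∀ i ≤ k, θ (i * K) ω ∈ U} :=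
        fun ω h i hi => h i (by omega)
      calc ∫ ω in {ω | ∀ i ≤ k + 1, θ (i * K) ω ∈ U}, Ψ (θ ((k + 1) * K) ω) ∂μ
          ≤ ∫ ω in {ω | ∀ i ≤ k, θ (i * K) ω ∈ U}, Ψ (θ ((k + 1) * K) ω) ∂μ := by
            refine setIntegral_mono_set (hΨint _).integrableOn ?_ hsub.eventuallyLE
            refine ae_restrict_of_ae ?_
            filter_upwards [hstay ((k + 1) * K)] with ω hω
            exact hΨnonneg _ hω
        _ = ∫ ω in {ω | ∀ i ≤ k, θ (i * K) ω ∈ U}, Ψ (θ (k * K + K) ω) ∂μ := by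
            rw [Nat.succ_mul]
        _ ≤ c K * ∫ ω in {ω | ∀ i ≤ k, θ (i * K) ω ∈ U}, Ψ (θ (k * K) ω) ∂μ :=
            hstep (k * K) K _ hK1 (hmeas k) (fun ω h => h k le_rfl)
        _ ≤ c K * (γα ^ (k * K) * Ψ θ₀) :=
            mul_le_mul_of_nonneg_left ih (hcpos K hK1).le
        _ = γα ^ ((k + 1) * K) * Ψ θ₀ := by rw [hcK, Nat.succ_mul, pow_add]; ring
  intro n hn
  obtain ⟨k, hk⟩ : ∃ k, k = (n - 1) / K := ⟨_, rfl⟩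
  rw [← hk]
  obtain ⟨r, hr⟩ : ∃ r, r = (n - 1) % K + 1 := ⟨_, rfl⟩
  have hrK : r ≤ K := by
    have := Nat.mod_lt (n - 1) hK1
    omega
  have hnr : n = k * K + r := by
    have := Nat.div_add_mod (n - 1) K
    rw [← hk, mul_comm] at this
    omega
  have hr1 : 1 ≤ r := by omega
  have hΨ0 : 0 ≤ Ψ θ₀ := hΨnonneg _ (hUΘ hθ₀U)
  rw [hnr]
  calc ∫ ω in {ω | ∀ i ≤ k, θ (i * K) ω ∈ U}, Ψ (θ (k * K + r) ω) ∂μ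
      ≤ c r * ∫ ω in {ω | ∀ i ≤ k, θ (i * K) ω ∈ U}, Ψ (θ (k * K) ω) ∂μ :=
        hstep (k * K) r _ hr1 (hmeas k) (fun ω h => h k le_rfl)
    _ ≤ c r * (γα ^ (k * K) * Ψ θ₀) := mul_le_mul_of_nonneg_left (hblock k) (hcpos r hr1).le
    _ ≤ (γbar * γα ^ r / γα ^ (K - 1)) * (γα ^ (k * K) * Ψ θ₀) := by
        refine mul_le_mul_of_nonneg_right ?_ (by positivity)
        rw [le_div_iff₀ (by positivity)]
        exact harith r hr1 hrK
    _ = (γbar / γα ^ (K - 1)) * γα ^ (k * K + r) * Ψ θ₀ := by rw [pow_add]; ring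
end

section
/- Under the local conditions (open U ⊆ Θ with {Ψ < ζ} ⊆ U, A3, A4), with α ∈ Λ, θ₀ ∈ U, events Ω_k = ⋂_{i=0}^{k} [θ_{i N*_α} ∈ U], and γ̄_α as defined, for every n ≥ 1 and every ε > 0: Pr[Ψ(θ_n) < ε] ≥ Pr[Ω_{⌊n/N*_α⌋}] − (Ψ(θ₀)/ε) γ_α^n (γ̄_α / γ_α^{N*_α − 1}). -/
open MeasureTheory Filter

/-- **Probability bound on `Ψ(θ_n) < ε` (Theorem 6.1 (3)).**
Under the local conditions A3 and A4 on an open set `U ⊇ {Ψ < ζ}`, for `α ∈ Λ` and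
`θ₀ ∈ U`, with `Ω_k = ⋂_{i=0}^k [θ_{i N*_α} ∈ U]`, for every `n ≥ 1` and `ε > 0`:
`Pr[Ψ(θ_n) < ε] ≥ Pr[Ω_{⌊n/N*_α⌋}] − (Ψ(θ₀)/ε) γ_α^n (γ̄_α/γ_α^{N*_α−1})`. -/
theorem stmt13 {D : ℕ} {Ω : Type} {m0 : MeasurableSpace Ω}
    (μ : Measure Ω) [IsProbabilityMeasure μ]
    (𝔉 : Filtration ℕ m0)
    (Θ U : Set (EuclideanSpace ℝ (Fin D)))
    (hUopen : IsOpen U) (hUΘ : U ⊆ Θ)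
    (θ : ℕ → Ω → EuclideanSpace ℝ (Fin D))
    (Fn : ℕ → Ω → EuclideanSpace ℝ (Fin D))
    (F : EuclideanSpace ℝ (Fin D) → EuclideanSpace ℝ (Fin D))
    (φ : ℝ → EuclideanSpace ℝ (Fin D) → EuclideanSpace ℝ (Fin D))
    (Ψ : EuclideanSpace ℝ (Fin D) → ℝ)
    (α : ℝ) (hα : 0 < α)
    -- the stochastic algorithm, with mean field `F`, adapted to the filtration
    (hrec : ∀ n ω, θ (n + 1) ω = θ n ω + α • Fn n ω)
    (hadapted : Adapted 𝔉 θ)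
    (hmean : ∀ n, μ[Fn n | 𝔉 n] =ᵐ[μ] fun ω => F (θ n ω))
    (hstay : ∀ n, ∀ᵐ ω ∂μ, θ n ω ∈ Θ)
    -- deterministic initialization in `U`
    (θ₀ : EuclideanSpace ℝ (Fin D)) (hθ₀U : θ₀ ∈ U) (hθ₀ : ∀ ω, θ 0 ω = θ₀)
    -- the mean flow
    (hflow0 : ∀ ϑ ∈ Θ, φ 0 ϑ = ϑ)
    (hflowInt : ∀ ϑ ∈ Θ, ∀ t : ℝ, 0 ≤ t →
      IntervalIntegrable (fun τ => F (φ τ ϑ)) volume 0 t)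
    (hflow : ∀ ϑ ∈ Θ, ∀ t : ℝ, 0 ≤ t → φ t ϑ = ϑ + ∫ τ in (0:ℝ)..t, F (φ τ ϑ))
    (hflowstay : ∀ ϑ ∈ Θ, ∀ t : ℝ, 0 ≤ t → φ t ϑ ∈ Θ)
    (hΨnonneg : ∀ ϑ ∈ Θ, 0 ≤ Ψ ϑ)
    (hΨint : ∀ n, Integrable (fun ω => Ψ (θ n ω)) μ)
    -- the sublevel set `{Ψ < ζ}` is contained in `U`
    (ζ : ℝ) (hζ : 0 < ζ) (hζU : {ϑ | ϑ ∈ Θ ∧ Ψ ϑ < ζ} ⊆ U)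
    -- condition A3
    (Δ₃ : ℝ → ℝ)
    (hΔ₃nonneg : ∀ t : ℝ, 0 ≤ t → 0 ≤ Δ₃ t)
    (hΔ₃anti : AntitoneOn Δ₃ (Set.Ici 0))
    (hΔ₃lim : Tendsto Δ₃ atTop (nhds 0))
    (hA3 : ∀ ϑ ∈ U, ∀ t : ℝ, 0 ≤ t → Ψ (φ t ϑ) ≤ Δ₃ t * Ψ ϑ)
    -- condition A4
    (Δ₄ : ℝ → ℝ → ℝ)
    (hΔ₄pos : ∀ a T : ℝ, 0 < a → 0 < T → 0 < Δ₄ a T)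
    (hΔ₄mono₁ : ∀ T : ℝ, 0 < T → MonotoneOn (fun a => Δ₄ a T) (Set.Ioi 0))
    (hΔ₄mono₂ : ∀ a : ℝ, 0 < a → MonotoneOn (Δ₄ a) (Set.Ioi 0))
    (hΔ₄lim : ∀ T : ℝ, 0 < T →
      Tendsto (fun a => Δ₄ a T) (nhdsWithin 0 (Set.Ioi 0)) (nhds 0))
    (hA4 : ∀ n N : ℕ, 1 ≤ N → ∀ᵐ ω ∂μ, θ n ω ∈ U →
      (μ[fun ω' => Ψ (θ (n + N) ω') | 𝔉 n]) ω
        ≤ Ψ (φ ((N : ℝ) * α) (θ n ω)) + Δ₄ α ((N : ℝ) * α) * Ψ (θ n ω))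
    -- the convergence rate `γ_α` and the step size `α ∈ Λ`
    (γα : ℝ)
    (hγα : γα =
      ⨅ N : ℕ+, (Δ₃ (((N : ℕ) : ℝ) * α) + Δ₄ α (((N : ℕ) : ℝ) * α)) ^ ((1:ℝ) / ((N : ℕ) : ℝ)))
    (hαΛ : γα < 1)
    -- `N*_α`: the smallest `N ≥ 1` attaining the infimum
    (Nstar : ℕ+)
    (hNstar : (Δ₃ (((Nstar : ℕ) : ℝ) * α) + Δ₄ α (((Nstar : ℕ) : ℝ) * α))
        ^ ((1:ℝ) / ((Nstar : ℕ) : ℝ)) = γα)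
    (hNstarMin : ∀ M : ℕ+,
      (Δ₃ (((M : ℕ) : ℝ) * α) + Δ₄ α (((M : ℕ) : ℝ) * α)) ^ ((1:ℝ) / ((M : ℕ) : ℝ)) = γα →
      Nstar ≤ M)
    -- `γ̄_α`
    (γbar : ℝ)
    (hγbar1 : (Nstar : ℕ) = 1 → γbar = 1)
    (hγbar2 : 1 < (Nstar : ℕ) →
      (∀ N : ℕ, 1 ≤ N → N < (Nstar : ℕ) →
        Δ₃ ((N : ℝ) * α) + Δ₄ α ((N : ℝ) * α) ≤ γbar) ∧
      (∃ N : ℕ, 1 ≤ N ∧ N < (Nstar : ℕ) ∧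
        γbar = Δ₃ ((N : ℝ) * α) + Δ₄ α ((N : ℝ) * α))) :
    ∀ n : ℕ, 1 ≤ n → ∀ ε : ℝ, 0 < ε →
      (μ {ω | ∀ i ≤ n / (Nstar : ℕ), θ (i * (Nstar : ℕ)) ω ∈ U}).toReal
          - (Ψ θ₀ / ε) * γα ^ n * (γbar / γα ^ ((Nstar : ℕ) - 1))
        ≤ (μ {ω | Ψ (θ n ω) < ε}).toReal := by
  set g : ℕ → ℝ := fun N => Δ₃ ((N : ℝ) * α) + Δ₄ α ((N : ℝ) * α) with hg
  have hgpos : ∀ N : ℕ, 1 ≤ N → 0 < g N := by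
    intro N hN
    have hNα : 0 < (N : ℝ) * α := mul_pos (by exact_mod_cast hN) hα
    exact add_pos_of_nonneg_of_pos (hΔ₃nonneg _ hNα.le) (hΔ₄pos _ _ hα hNα)
  have hγpos : 0 < γα := by
    rw [← hNstar]
    exact Real.rpow_pos_of_pos (hgpos _ Nstar.pos) _
  have hγle : ∀ N : ℕ, 1 ≤ N → γα ^ N ≤ g N := by
    intro N hN
    have h1 : γα ≤ g N ^ ((1:ℝ) / (N : ℝ)) := by
      rw [hγα]
      refine ciInf_le (f := fun N : ℕ+ => g (N : ℕ) ^ ((1:ℝ) / ((N : ℕ) : ℝ))) ⟨0, ?_⟩ ⟨N, hN⟩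
      rintro _ ⟨M, rfl⟩
      exact (Real.rpow_pos_of_pos (hgpos _ M.pos) _).le
    calc γα ^ N ≤ (g N ^ ((1:ℝ) / (N : ℝ))) ^ N := pow_le_pow_left₀ hγpos.le h1 N
      _ = g N := by
        rw [one_div]
        exact Real.rpow_inv_natCast_pow (hgpos N hN).le (by omega)
  have hγN : g Nstar = γα ^ (Nstar : ℕ) := by
    rw [← hNstar, one_div]
    exact (Real.rpow_inv_natCast_pow (hgpos _ Nstar.pos).le (by have := Nstar.pos; omega)).symm
  have hΨae : ∀ n, ∀ᵐ ω ∂μ, 0 ≤ Ψ (θ n ω) := by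
    intro n
    filter_upwards [hstay n] with ω hω using hΨnonneg _ hω
  have hUm : ∀ m n, m ≤ n → MeasurableSet[𝔉 n] {ω | θ m ω ∈ U} := by
    intro m n hmn
    have h1 : MeasurableSet[𝔉 m] (θ m ⁻¹' U) := hadapted m hUopen.measurableSet
    exact 𝔉.mono hmn _ h1
  have step : ∀ (n M : ℕ) (S : Set Ω), 1 ≤ M → MeasurableSet[𝔉 n] S → S ⊆ {ω | θ n ω ∈ U} →
      ∫ ω in S, Ψ (θ (n + M) ω) ∂μ ≤ g M * ∫ ω in S, Ψ (θ n ω) ∂μ := by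
    intro n M S hM hS hSU
    rw [← setIntegral_condExp (𝔉.le n) (hΨint (n + M)) hS, ← integral_const_mul]
    refine setIntegral_mono_on_ae integrable_condExp.integrableOn
      ((hΨint n).const_mul _).integrableOn (𝔉.le n _ hS) ?_
    filter_upwards [hA4 n M hM] with ω hω hωS
    have h1 := hω (hSU hωS)
    have h2 := hA3 _ (hSU hωS) ((M : ℝ) * α) (by positivity)
    have h3 : g M = Δ₃ ((M : ℝ) * α) + Δ₄ α ((M : ℝ) * α) := rfl
    rw [h3, add_mul]
    linarith
  let W : ℕ → Set Ω := fun k => {ω | ∀ i ≤ k, θ (i * (Nstar : ℕ)) ω ∈ U}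
  have hWm : ∀ k, MeasurableSet[𝔉 (k * (Nstar : ℕ))] (W k) := by
    intro k
    have : W k = ⋂ i, ⋂ (_ : i ≤ k), {ω | θ (i * (Nstar : ℕ)) ω ∈ U} := by
      ext ω; simp [W]
    rw [this]
    exact MeasurableSet.iInter fun i => MeasurableSet.iInter fun hi =>
      hUm _ _ (Nat.mul_le_mul_right _ hi)
  have hWU : ∀ k, W k ⊆ {ω | θ (k * (Nstar : ℕ)) ω ∈ U} := fun k ω hω => hω k le_rfl
  have hΨ0 : 0 ≤ Ψ θ₀ := hΨnonneg _ (hUΘ hθ₀U)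
  have main : ∀ k, ∫ ω in W k, Ψ (θ (k * (Nstar : ℕ)) ω) ∂μ
      ≤ γα ^ (k * (Nstar : ℕ)) * Ψ θ₀ := by
    intro k
    induction k with
    | zero =>
      have hW0 : W 0 = Set.univ := by
        ext ω
        simp [W, hθ₀, hθ₀U]
      rw [hW0]
      simp [hθ₀]
    | succ k ih =>
      have h1 : ∫ ω in W (k + 1), Ψ (θ ((k + 1) * (Nstar : ℕ)) ω) ∂μ
          ≤ ∫ ω in W k, Ψ (θ ((k + 1) * (Nstar : ℕ)) ω) ∂μ := by
        refine setIntegral_mono_set (hΨint _).integrableOn (ae_restrict_of_ae (hΨae _)) ?_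
        exact Filter.Eventually.of_forall fun ω hω i hi => hω i (by omega)
      have h2 := step (k * (Nstar : ℕ)) Nstar (W k) Nstar.pos (hWm k) (hWU k)
      rw [← Nat.succ_mul] at h2
      rw [hγN] at h2
      calc _ ≤ _ := h1
        _ ≤ _ := h2
        _ ≤ γα ^ (Nstar : ℕ) * (γα ^ (k * (Nstar : ℕ)) * Ψ θ₀) :=
          mul_le_mul_of_nonneg_left ih (by positivity)
        _ = _ := by ring
  intro n hn ε hε
  have hdm := Nat.div_add_mod' n (Nstar : ℕ)
  have hmod := Nat.mod_lt n Nstar.pos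
  set k := n / (Nstar : ℕ) with hk
  set r := n % (Nstar : ℕ) with hr
  have hNpos : 0 < (Nstar : ℕ) := Nstar.pos
  have bound : ∫ ω in W k, Ψ (θ n ω) ∂μ
      ≤ Ψ θ₀ * γα ^ n * (γbar / γα ^ ((Nstar : ℕ) - 1)) := by
    rcases Nat.eq_zero_or_pos r with h0 | hrpos
    · have hnk : k * (Nstar : ℕ) = n := by omega
      have h1 := main k
      rw [hnk] at h1
      refine h1.trans ?_
      have h2 : 1 ≤ γbar / γα ^ ((Nstar : ℕ) - 1) := by
        rw [one_le_div (by positivity)]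
        rcases Nat.lt_or_ge 1 (Nstar : ℕ) with h | h
        · exact (hγle _ (by omega)).trans ((hγbar2 h).1 _ (by omega) (by omega))
        · have hN1 : (Nstar : ℕ) = 1 := by omega
          rw [hγbar1 hN1, hN1]; simp
      rw [mul_comm (γα ^ n)]
      exact le_mul_of_one_le_right (by positivity) h2
    · have h1 := step (k * (Nstar : ℕ)) r (W k) hrpos (hWm k) (hWU k)
      rw [hdm] at h1
      have h2 : g r ≤ γbar := (hγbar2 (by omega)).1 r hrpos hmod
      have hb : 0 < γbar := (hgpos r hrpos).trans_le h2
      have h3 : γα ^ (k * (Nstar : ℕ)) ≤ γα ^ n / γα ^ ((Nstar : ℕ) - 1) := by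
        rw [le_div_iff₀ (by positivity), ← pow_add]
        exact pow_le_pow_of_le_one hγpos.le hαΛ.le (by omega)
      calc _ ≤ _ := h1
        _ ≤ g r * (γα ^ (k * (Nstar : ℕ)) * Ψ θ₀) :=
          mul_le_mul_of_nonneg_left (main k) (hgpos r hrpos).le
        _ ≤ γbar * (γα ^ n / γα ^ ((Nstar : ℕ) - 1) * Ψ θ₀) := by gcongr
        _ = _ := by ring
  have markov : ε * (μ.restrict (W k)).real {ω | ε ≤ Ψ (θ n ω)} ≤ ∫ ω in W k, Ψ (θ n ω) ∂μ :=
    mul_meas_ge_le_integral_of_nonneg (ae_restrict_of_ae (hΨae n)) (hΨint n).integrableOn ε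
  have hWm0 : MeasurableSet (W k) := 𝔉.le _ _ (hWm k)
  have hr2 : (μ.restrict (W k)).real {ω | ε ≤ Ψ (θ n ω)}
      = μ.real ({ω | ε ≤ Ψ (θ n ω)} ∩ W k) := by
    simp only [Measure.real, Measure.restrict_apply' hWm0]
  rw [hr2] at markov
  have hsub : μ.real (W k) ≤ μ.real {ω | Ψ (θ n ω) < ε}
      + μ.real ({ω | ε ≤ Ψ (θ n ω)} ∩ W k) := by
    refine le_trans (measureReal_mono ?_) (measureReal_union_le _ _)
    intro ω hω
    rcases lt_or_ge (Ψ (θ n ω)) ε with h | h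
    · exact Or.inl h
    · exact Or.inr ⟨h, hω⟩
  have hfin : μ.real ({ω | ε ≤ Ψ (θ n ω)} ∩ W k)
      ≤ (Ψ θ₀ / ε) * γα ^ n * (γbar / γα ^ ((Nstar : ℕ) - 1)) := by
    have : (Ψ θ₀ / ε) * γα ^ n * (γbar / γα ^ ((Nstar : ℕ) - 1))
        = (Ψ θ₀ * γα ^ n * (γbar / γα ^ ((Nstar : ℕ) - 1))) / ε := by ring
    rw [this, le_div_iff₀ hε, mul_comm]
    exact markov.trans bound
  change μ.real (W k) - _ ≤ μ.real {ω | Ψ (θ n ω) < ε}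
  linarith
end

section
/- Improved Chebyshev sum inequality: Let (X, 𝔉, P) be a probability space and f, g: X → R be P-integrable with finite expectations such that (f(x) − f(y))(g(x) − g(y)) ≥ 0 for (P ⊗ P)-almost every (x, y) ∈ X², and with E[f(X) g(X)] well-defined. Define f₁ = f, g₁ = g, and recursively f_i(x) = E_Y[(f_{i−1}(x) − f_{i−1}(Y)) 1{f_{i−1}(Y) < f_{i−1}(x)}], g_i(x) = E_Y[(g_{i−1}(x) − g_{i−1}(Y)) 1{g_{i−1}(Y) < g_{i−1}(x)}] for i ≥ 2, where Y has law P. Then for every integer K ≥ 1: E[f(X) g(X)] ≥ Σ_{i=1}^{K} E[f_i(X)] E[g_i(X)]. Moreover, for i ≥ 2, E[f_i(X)] = (1/2) E[|f_{i−1}(X) − f_{i−1}(Y)|] and E[g_i(X)] = (1/2) E[|g_{i−1}(X) − g_{i−1}(Y)|] where X, Y are i.i.d. with law P. -/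
open MeasureTheory

namespace Cheb

variable {X : Type} [MeasurableSpace X] {P : Measure X} [IsProbabilityMeasure P]

/-- The step operator. -/
noncomputable def T (P : Measure X) (f : X → ℝ) (x : X) : ℝ := ∫ y, max (f x - f y) 0 ∂P

/-- The invariant kept along the recursion. -/
structure Good (P : Measure X) (f g : X → ℝ) : Prop where
  fm : Measurable f
  gm : Measurable g
  fi : Integrable f P
  gi : Integrable g P
  fg : Integrable (fun x => f x * g x) P
  corr : ∀ᵐ p ∂(P.prod P), 0 ≤ (f p.1 - f p.2) * (g p.1 - g p.2)

lemma int_pos (f : X → ℝ) (hf : Integrable f P) (c : ℝ) :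
    Integrable (fun y => max (c - f y) 0) P :=
  ((integrable_const c).sub hf).sup (integrable_const 0)

lemma int_prod (f : X → ℝ) (hf : Integrable f P) :
    Integrable (fun p : X × X => f p.1 - f p.2) (P.prod P) :=
  (hf.comp_fst P).sub (hf.comp_snd P)

lemma int_prod_pos (f : X → ℝ) (hf : Integrable f P) :
    Integrable (fun p : X × X => max (f p.1 - f p.2) 0) (P.prod P) :=
  (int_prod f hf).sup (integrable_const 0)

lemma T_nonneg (f : X → ℝ) (x : X) : 0 ≤ T P f x :=
  integral_nonneg fun _ => le_max_right _ _

lemma T_mono (f : X → ℝ) (hf : Integrable f P) {x y : X} (h : f x ≤ f y) :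
    T P f x ≤ T P f y :=
  integral_mono (int_pos f hf _) (int_pos f hf _) fun z => by
    dsimp only
    gcongr

lemma T_eq (f : X → ℝ) {x y : X} (h : f x = f y) : T P f x = T P f y := by
  unfold T
  rw [h]

lemma T_meas (f : X → ℝ) (hf : Measurable f) : Measurable (T P f) := by
  have : StronglyMeasurable (fun p : X × X => max (f p.1 - f p.2) 0) :=
    (((hf.comp measurable_fst).sub (hf.comp measurable_snd)).max
      measurable_const).stronglyMeasurable
  exact this.integral_prod_right'.measurable

lemma T_int (f : X → ℝ) (hf : Integrable f P) : Integrable (T P f) P :=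
  (int_prod_pos f hf).integral_prod_left

lemma T_bound (f : X → ℝ) (hf : Integrable f P) (x : X) :
    T P f x ≤ |f x| + ∫ y, |f y| ∂P := by
  have h1 : ∫ y, (|f x| + |f y|) ∂P = |f x| + ∫ y, |f y| ∂P := by
    rw [integral_add (integrable_const _) hf.abs]; simp
  rw [← h1]
  refine integral_mono (int_pos f hf _) ((integrable_const _).add hf.abs) fun y => ?_
  dsimp only
  have := le_abs_self (f x)
  have := neg_abs_le (f y)
  exact max_le (by linarith) (by positivity)

lemma T_integral (f : X → ℝ) (hf : Integrable f P) :
    ∫ x, T P f x ∂P = (1 / 2) * ∫ p, |f p.1 - f p.2| ∂(P.prod P) := by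
  have h1 : ∫ x, T P f x ∂P = ∫ p : X × X, max (f p.1 - f p.2) 0 ∂(P.prod P) :=
    (integral_prod _ (int_prod_pos f hf)).symm
  have h2 : ∫ p : X × X, max (f p.2 - f p.1) 0 ∂(P.prod P)
      = ∫ p : X × X, max (f p.1 - f p.2) 0 ∂(P.prod P) :=
    integral_prod_swap (μ := P) (ν := P) (fun p : X × X => max (f p.1 - f p.2) 0)
  have h3 : Integrable (fun p : X × X => max (f p.2 - f p.1) 0) (P.prod P) :=
    (int_prod_pos f hf).swap
  have h4 : ∫ p, |f p.1 - f p.2| ∂(P.prod P)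
      = ∫ p : X × X, (max (f p.1 - f p.2) 0 + max (f p.2 - f p.1) 0) ∂(P.prod P) := by
    congr 1
    ext p
    rcases le_total (f p.1) (f p.2) with h | h
    · rw [abs_of_nonpos (by linarith), max_eq_right (by linarith), max_eq_left (by linarith)]
      ring
    · rw [abs_of_nonneg (by linarith), max_eq_left (by linarith), max_eq_right (by linarith)]
      ring
  rw [h4, integral_add (int_prod_pos f hf) h3, h2, h1]
  ring

/-- All four products of the expansion are integrable, with its integral. -/
lemma prod_expand (f g : X → ℝ) (h : Good P f g) :
    Integrable (fun p : X × X => (f p.1 - f p.2) * (g p.1 - g p.2)) (P.prod P) ∧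
    ∫ p, (f p.1 - f p.2) * (g p.1 - g p.2) ∂(P.prod P)
      = 2 * (∫ x, f x * g x ∂P - (∫ x, f x ∂P) * ∫ x, g x ∂P) := by
  have a1 : Integrable (fun p : X × X => f p.1 * g p.1) (P.prod P) := h.fg.comp_fst P
  have a2 : Integrable (fun p : X × X => f p.2 * g p.2) (P.prod P) := h.fg.comp_snd P
  have a3 : Integrable (fun p : X × X => f p.1 * g p.2) (P.prod P) := h.fi.mul_prod h.gi
  have a4 : Integrable (fun p : X × X => g p.1 * f p.2) (P.prod P) := h.gi.mul_prod h.fi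
  have e : (fun p : X × X => (f p.1 - f p.2) * (g p.1 - g p.2))
      = fun p => (f p.1 * g p.1 + f p.2 * g p.2) - (f p.1 * g p.2 + g p.1 * f p.2) := by
    ext p; ring
  rw [e]
  have b1 : Integrable (fun p : X × X => f p.1 * g p.1 + f p.2 * g p.2) (P.prod P) := a1.add a2
  have b2 : Integrable (fun p : X × X => f p.1 * g p.2 + g p.1 * f p.2) (P.prod P) := a3.add a4
  refine ⟨b1.sub b2, ?_⟩
  rw [integral_sub b1 b2, integral_add a1 a2, integral_add a3 a4,
    integral_prod_mul, integral_prod_mul,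
    integral_fun_fst (μ := P) (ν := P) (fun x => f x * g x),
    integral_fun_snd (μ := P) (ν := P) (fun x => f x * g x)]
  simp
  ring

lemma chebyshev (f g : X → ℝ) (h : Good P f g) :
    (∫ x, f x ∂P) * ∫ x, g x ∂P ≤ ∫ x, f x * g x ∂P := by
  have := integral_nonneg_of_ae (μ := P.prod P) h.corr
  rw [(prod_expand f g h).2] at this
  linarith

lemma good_pos (f g : X → ℝ) (h : Good P f g) (a b : ℝ) :
    Good P (fun y => max (a - f y) 0) (fun y => max (b - g y) 0) where
  fm := (measurable_const.sub h.fm).max measurable_const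
  gm := (measurable_const.sub h.gm).max measurable_const
  fi := int_pos f h.fi a
  gi := int_pos g h.gi b
  fg := by
    have hm : Measurable (fun y => max (a - f y) 0 * max (b - g y) 0) :=
      ((measurable_const.sub h.fm).max measurable_const).mul
        ((measurable_const.sub h.gm).max measurable_const)
    have hi : Integrable (fun y => (a - f y) * (b - g y)) P := by
      have e : (fun y => (a - f y) * (b - g y))
          = fun y => (a * b - a * g y) - (b * f y - f y * g y) := by ext y; ring
      rw [e]
      exact ((integrable_const _).sub (h.gi.const_mul a)).sub ((h.fi.const_mul b).sub h.fg)
    refine hi.mono hm.aestronglyMeasurable (Filter.Eventually.of_forall fun y => ?_)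
    rw [norm_mul, norm_mul]
    gcongr <;>
    · rw [Real.norm_eq_abs, Real.norm_eq_abs, abs_of_nonneg (le_max_right _ _)]
      exact max_le (le_abs_self _) (abs_nonneg _)
  corr := by
    filter_upwards [h.corr] with p hp
    rcases lt_trichotomy (f p.1) (f p.2) with h1 | h1 | h1
    · have h2 : g p.1 ≤ g p.2 := by nlinarith
      exact mul_nonneg (sub_nonneg.2 (max_le_max (by linarith) le_rfl))
        (sub_nonneg.2 (max_le_max (by linarith) le_rfl))
    · simp [h1]
    · have h2 : g p.2 ≤ g p.1 := by nlinarith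
      exact mul_nonneg_of_nonpos_of_nonpos (sub_nonpos.2 (max_le_max (by linarith) le_rfl))
        (sub_nonpos.2 (max_le_max (by linarith) le_rfl))

lemma good_T (f g : X → ℝ) (h : Good P f g) : Good P (T P f) (T P g) where
  fm := T_meas f h.fm
  gm := T_meas g h.gm
  fi := T_int f h.fi
  gi := T_int g h.gi
  fg := by
    set A := ∫ y, |f y| ∂P
    set B := ∫ y, |g y| ∂P
    have hi : Integrable (fun x => (|f x| + A) * (|g x| + B)) P := by
      have e : (fun x => (|f x| + A) * (|g x| + B))
          = fun x => |f x * g x| + B * |f x| + (A * |g x| + A * B) := by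
        ext y; rw [abs_mul]; ring
      rw [e]
      exact (h.fg.abs.add (h.fi.abs.const_mul B)).add
        ((h.gi.abs.const_mul A).add (integrable_const _))
    refine hi.mono ((T_meas f h.fm).mul (T_meas g h.gm)).aestronglyMeasurable
      (Filter.Eventually.of_forall fun y => ?_)
    rw [Real.norm_of_nonneg (mul_nonneg (T_nonneg f y) (T_nonneg g y))]
    refine le_trans ?_ (le_abs_self _)
    exact mul_le_mul (T_bound f h.fi y) (T_bound g h.gi y) (T_nonneg g y)
      ((T_nonneg f y).trans (T_bound f h.fi y))
  corr := by
    filter_upwards [h.corr] with p hp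
    rcases lt_trichotomy (f p.1) (f p.2) with h1 | h1 | h1
    · have h2 : g p.1 ≤ g p.2 := by nlinarith
      exact mul_nonneg_of_nonpos_of_nonpos (sub_nonpos.2 (T_mono f h.fi h1.le))
        (sub_nonpos.2 (T_mono g h.gi h2))
    · rw [T_eq f h1]; simp
    · have h2 : g p.2 ≤ g p.1 := by nlinarith
      exact mul_nonneg (sub_nonneg.2 (T_mono f h.fi h1.le))
        (sub_nonneg.2 (T_mono g h.gi h2))

lemma step (f g : X → ℝ) (h : Good P f g) :
    (∫ x, f x ∂P) * (∫ x, g x ∂P) + ∫ x, T P f x * T P g x ∂P ≤ ∫ x, f x * g x ∂P := by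
  let H : X × X → ℝ := fun p => max (f p.1 - f p.2) 0 * max (g p.1 - g p.2) 0
  obtain ⟨hi, hE⟩ := prod_expand f g h
  have hm : Measurable H :=
    (((h.fm.comp measurable_fst).sub (h.fm.comp measurable_snd)).max measurable_const).mul
      (((h.gm.comp measurable_fst).sub (h.gm.comp measurable_snd)).max measurable_const)
  have hH : Integrable H (P.prod P) := by
    refine hi.mono hm.aestronglyMeasurable (Filter.Eventually.of_forall fun y => ?_)
    rw [norm_mul, norm_mul]
    gcongr <;>
    · rw [Real.norm_eq_abs, Real.norm_eq_abs, abs_of_nonneg (le_max_right _ _)]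
      exact max_le (le_abs_self _) (abs_nonneg _)
  have hsw : ∫ p, H p.swap ∂(P.prod P) = ∫ p, H p ∂(P.prod P) := integral_prod_swap H
  have hsum : ∫ p, (f p.1 - f p.2) * (g p.1 - g p.2) ∂(P.prod P)
      = ∫ p, (H p + H p.swap) ∂(P.prod P) := by
    refine integral_congr_ae ?_
    filter_upwards [h.corr] with p hp
    simp only [H, Prod.fst_swap, Prod.snd_swap]
    rcases lt_trichotomy (f p.1) (f p.2) with h1 | h1 | h1
    · have h2 : g p.1 ≤ g p.2 := by nlinarith
      rw [max_eq_right (a := f p.1 - f p.2) (by linarith),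
        max_eq_left (a := f p.2 - f p.1) (by linarith),
        max_eq_left (a := g p.2 - g p.1) (by linarith)]
      ring
    · simp [h1]
    · have h2 : g p.2 ≤ g p.1 := by nlinarith
      rw [max_eq_right (a := f p.2 - f p.1) (by linarith),
        max_eq_left (a := f p.1 - f p.2) (by linarith),
        max_eq_left (a := g p.1 - g p.2) (by linarith)]
      ring
  have hsum2 : ∫ p, (H p + H p.swap) ∂(P.prod P)
      = ∫ p, H p ∂(P.prod P) + ∫ p, H p.swap ∂(P.prod P) := integral_add hH hH.swap
  have hle : ∫ x, T P f x * T P g x ∂P ≤ ∫ p, H p ∂(P.prod P) := by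
    rw [integral_prod _ hH]
    exact integral_mono (good_T f g h).fg hH.integral_prod_left
      fun x => chebyshev _ _ (good_pos f g h (f x) (g x))
  linarith

lemma ite_eq (a b : ℝ) : (if a < b then b - a else 0) = max (b - a) 0 := by
  split_ifs with h
  · rw [max_eq_left (by linarith)]
  · rw [max_eq_right (by linarith)]

end Cheb

/-- **Improved Chebyshev sum inequality.**  Let `(X, 𝔉, P)` be a probability space and
`f, g : X → ℝ` integrable functions that are almost surely non-negatively correlated,
i.e. `(f x − f y)(g x − g y) ≥ 0` for `(P ⊗ P)`-a.e. `(x, y)`, and such that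
`E[f g]` is well defined.  Define `f₁ = f`, `g₁ = g` and, for `i ≥ 2`,
`fᵢ(x) = E_Y[(f_{i−1}(x) − f_{i−1}(Y)) 1{f_{i−1}(Y) < f_{i−1}(x)}]` (similarly `gᵢ`).
Then for every `K ≥ 1`, `E[f g] ≥ Σ_{i=1}^K E[fᵢ] E[gᵢ]`; moreover for `i ≥ 2`,
`E[fᵢ] = ½ E[|f_{i−1}(X) − f_{i−1}(Y)|]` and `E[gᵢ] = ½ E[|g_{i−1}(X) − g_{i−1}(Y)|]`
with `X, Y` i.i.d. of law `P`. -/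
theorem stmt17 {X : Type} [MeasurableSpace X] (P : Measure X) [IsProbabilityMeasure P]
    (f g : X → ℝ) (hfm : Measurable f) (hgm : Measurable g)
    (hfi : Integrable f P) (hgi : Integrable g P)
    (hfg : Integrable (fun x => f x * g x) P)
    (hcorr : ∀ᵐ p ∂(P.prod P), 0 ≤ (f p.1 - f p.2) * (g p.1 - g p.2))
    (fs gs : ℕ → X → ℝ)
    (hfs1 : fs 1 = f) (hgs1 : gs 1 = g)
    (hfsrec : ∀ i : ℕ, 1 ≤ i → ∀ x,
      fs (i + 1) x = ∫ y, (if fs i y < fs i x then fs i x - fs i y else 0) ∂P)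
    (hgsrec : ∀ i : ℕ, 1 ≤ i → ∀ x,
      gs (i + 1) x = ∫ y, (if gs i y < gs i x then gs i x - gs i y else 0) ∂P) :
    (∀ K : ℕ, 1 ≤ K →
      ∑ i ∈ Finset.Icc 1 K, (∫ x, fs i x ∂P) * (∫ x, gs i x ∂P) ≤ ∫ x, f x * g x ∂P) ∧
    (∀ i : ℕ, 2 ≤ i →
      (∫ x, fs i x ∂P) = (1 / 2) * ∫ p, |fs (i - 1) p.1 - fs (i - 1) p.2| ∂(P.prod P) ∧
      (∫ x, gs i x ∂P) = (1 / 2) * ∫ p, |gs (i - 1) p.1 - gs (i - 1) p.2| ∂(P.prod P)) := by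
  have hf' : ∀ i : ℕ, 1 ≤ i → fs (i + 1) = Cheb.T P (fs i) := fun i hi => by
    ext x; rw [hfsrec i hi x]; simp only [Cheb.ite_eq, Cheb.T]
  have hg' : ∀ i : ℕ, 1 ≤ i → gs (i + 1) = Cheb.T P (gs i) := fun i hi => by
    ext x; rw [hgsrec i hi x]; simp only [Cheb.ite_eq, Cheb.T]
  have good : ∀ i : ℕ, 1 ≤ i → Cheb.Good P (fs i) (gs i) := by
    intro i hi
    induction i, hi using Nat.le_induction with
    | base => rw [hfs1, hgs1]; exact ⟨hfm, hgm, hfi, hgi, hfg, hcorr⟩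
    | succ n hn ih => rw [hf' n hn, hg' n hn]; exact Cheb.good_T _ _ ih
  have main : ∀ K : ℕ, 1 ≤ K →
      ∑ i ∈ Finset.Icc 1 K, (∫ x, fs i x ∂P) * (∫ x, gs i x ∂P)
        + ∫ x, fs (K + 1) x * gs (K + 1) x ∂P ≤ ∫ x, f x * g x ∂P := by
    intro K hK
    induction K, hK using Nat.le_induction with
    | base =>
      have := Cheb.step _ _ (good 1 le_rfl)
      rw [← hf' 1 le_rfl, ← hg' 1 le_rfl] at this
      rw [Finset.Icc_self, Finset.sum_singleton]
      simpa only [hfs1, hgs1] using this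
    | succ n hn ih =>
      have := Cheb.step _ _ (good (n + 1) (by omega))
      rw [← hf' (n + 1) (by omega), ← hg' (n + 1) (by omega)] at this
      rw [Finset.sum_Icc_succ_top (by omega)]
      linarith
  refine ⟨fun K hK => ?_, fun i hi => ?_⟩
  · have h0 : 0 ≤ ∫ x, fs (K + 1) x * gs (K + 1) x ∂P := by
      rw [hf' K hK, hg' K hK]
      exact integral_nonneg fun x => mul_nonneg (Cheb.T_nonneg _ x) (Cheb.T_nonneg _ x)
    linarith [main K hK]
  · obtain ⟨j, rfl⟩ : ∃ j, i = j + 1 := ⟨i - 1, by omega⟩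
    have hj : 1 ≤ j := by omega
    rw [Nat.add_sub_cancel, hf' j hj, hg' j hj]
    exact ⟨Cheb.T_integral _ (good j hj).fi, Cheb.T_integral _ (good j hj).gi⟩
end

section
/- Let Y and Ỹ be i.i.d. real random variables with finite mean μ₁ = E[Y], variance μ₂ = E[(Y − μ₁)²], and fourth centered moment μ₄ = E[(Y − μ₁)⁴] < ∞. Then E[|Y − Ỹ|] ≥ 2 (μ₂³ / (μ₄ + 3 μ₂²))^{1/2}. -/
open MeasureTheory

lemma aux_final (A m2 m4 : ℝ) (hA : 0 ≤ A) (hm2 : 0 < m2) (hm4 : 0 ≤ m4)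
    (h : ∀ c : ℝ, 0 < c → 3 * c ^ 2 * m2 ≤ 2 * c ^ 3 * A + m4) : m2 ^ 3 ≤ A ^ 2 * m4 := by
  rcases hA.eq_or_lt with h0 | hpos
  · exfalso
    subst h0
    have h1 := h (m4 / m2 + 1) (by positivity)
    have h2 : m4 / m2 * m2 = m4 := by field_simp
    have h3 : 0 ≤ m4 / m2 := by positivity
    nlinarith [mul_nonneg (mul_nonneg h3 h3) hm2.le]
  · have h1 := h (m2 / A) (by positivity)
    have h2 : 3 * (m2 / A) ^ 2 * m2 = 3 * (m2 ^ 3 / A ^ 2) := by field_simp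
    have h3 : 2 * (m2 / A) ^ 3 * A = 2 * (m2 ^ 3 / A ^ 2) := by field_simp
    rw [h2, h3] at h1
    have h4 : m2 ^ 3 / A ^ 2 ≤ m4 := by linarith
    rw [div_le_iff₀ (by positivity)] at h4
    linarith

lemma aux_pt (c t : ℝ) (hc : 0 < c) : 3 * c ^ 2 * t ^ 2 ≤ 2 * c ^ 3 * |t| + t ^ 4 := by
  have h1 : t ^ 2 = |t| ^ 2 := (sq_abs t).symm
  have h2 : t ^ 4 = |t| ^ 4 := by
    rw [show t ^ 4 = (t ^ 2) ^ 2 by ring, h1]; ring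
  rw [h1, h2]
  have h3 : 0 ≤ |t| * ((|t| - c) ^ 2 * (|t| + 2 * c)) := by positivity
  nlinarith

lemma aux_int {Ω : Type} [MeasurableSpace Ω] (μ : Measure Ω) [IsProbabilityMeasure μ]
    (X : Ω → ℝ) (h : MemLp X 4 μ) (k : ℕ) (hk : k ≤ 4) :
    Integrable (fun ω => X ω ^ k) μ := by
  have h1 : MemLp X (k : ENNReal) μ := h.mono_exponent (by exact_mod_cast hk)
  have h2 := h1.integrable_norm_pow'
  refine h2.congr' (h.1.pow k) ?_
  filter_upwards with ω
  simp

/-- **Fourth-moment lower bound on the expected absolute difference of two i.i.d.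
random variables.**  If `Y` and `Z` are i.i.d. real random variables with mean `μ₁`,
variance `μ₂` and fourth centered moment `μ₄ < ∞`, then
`E[|Y − Z|] ≥ 2 (μ₂³ / (μ₄ + 3 μ₂²))^{1/2}`. -/
theorem stmt18 {Ω : Type} [MeasurableSpace Ω] (μ : Measure Ω) [IsProbabilityMeasure μ]
    (Y Z : Ω → ℝ) (hYm : Measurable Y) (hZm : Measurable Z)
    (hindep : ProbabilityTheory.IndepFun Y Z μ)
    (hident : Measure.map Y μ = Measure.map Z μ)
    (hY4 : Integrable (fun ω => (Y ω) ^ 4) μ)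
    (μ₁ μ₂ μ₄ : ℝ)
    (hμ₁ : μ₁ = ∫ ω, Y ω ∂μ)
    (hμ₂ : μ₂ = ∫ ω, (Y ω - μ₁) ^ 2 ∂μ)
    (hμ₄ : μ₄ = ∫ ω, (Y ω - μ₁) ^ 4 ∂μ) :
    2 * Real.sqrt (μ₂ ^ 3 / (μ₄ + 3 * μ₂ ^ 2)) ≤ ∫ ω, |Y ω - Z ω| ∂μ := by
  have hid : ProbabilityTheory.IdentDistrib Y Z μ μ := ⟨hYm.aemeasurable, hZm.aemeasurable, hident⟩
  have hYL : MemLp Y 4 μ := by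
    rw [← integrable_norm_rpow_iff hYm.aestronglyMeasurable (by norm_num) (by norm_num)]
    refine hY4.congr ?_
    filter_upwards with ω
    have h4 : (ENNReal.toReal 4) = ((4 : ℕ) : ℝ) := by simp
    rw [h4, Real.rpow_natCast, Real.norm_eq_abs, ← abs_pow, abs_of_nonneg (by positivity)]
  have hZL : MemLp Z 4 μ := hid.memLp_iff.1 hYL
  set X : Ω → ℝ := fun ω => Y ω - μ₁ with hX
  set V : Ω → ℝ := fun ω => Z ω - μ₁ with hV
  have hXL : MemLp X 4 μ := hYL.sub (memLp_const μ₁)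
  have hVL : MemLp V 4 μ := hZL.sub (memLp_const μ₁)
  have iX := aux_int μ X hXL
  have iV := aux_int μ V hVL
  have mom : ∀ k : ℕ, ∫ ω, V ω ^ k ∂μ = ∫ ω, X ω ^ k ∂μ := fun k =>
    (hid.comp (u := fun y => (y - μ₁) ^ k) (by fun_prop)).integral_eq.symm
  have ind : ∀ i j : ℕ, ProbabilityTheory.IndepFun (fun ω => X ω ^ i) (fun ω => V ω ^ j) μ :=
    fun i j => hindep.comp (φ := fun y => (y - μ₁) ^ i) (ψ := fun y => (y - μ₁) ^ j)
      (by fun_prop) (by fun_prop)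
  have iXV : ∀ i j : ℕ, i ≤ 4 → j ≤ 4 → Integrable (fun ω => X ω ^ i * V ω ^ j) μ :=
    fun i j hi hj => (ind i j).integrable_mul (iX i hi) (iV j hj)
  have eXV : ∀ i j : ℕ, i ≤ 4 → j ≤ 4 → ∫ ω, X ω ^ i * V ω ^ j ∂μ
      = (∫ ω, X ω ^ i ∂μ) * ∫ ω, X ω ^ j ∂μ := fun i j hi hj => by
    rw [← mom j]
    exact (ind i j).integral_fun_mul_eq_mul_integral (iX i hi).1 (iV j hj).1
  have e1 : ∫ ω, X ω ^ 1 ∂μ = 0 := by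
    simp only [pow_one, hX]
    rw [integral_sub (hYL.integrable (by norm_num)) (integrable_const _)]
    simp [← hμ₁]
  have e0 : ∫ ω, X ω ^ 0 ∂μ = 1 := by simp
  have e2 : ∫ ω, X ω ^ 2 ∂μ = μ₂ := hμ₂.symm
  have e4 : ∫ ω, X ω ^ 4 ∂μ = μ₄ := hμ₄.symm
  have E2 : ∫ ω, (Y ω - Z ω) ^ 2 ∂μ = 2 * μ₂ := by
    have : (fun ω => (Y ω - Z ω) ^ 2) = fun ω => X ω ^ 2 * V ω ^ 0 +
        ((-2) * (X ω ^ 1 * V ω ^ 1) + X ω ^ 0 * V ω ^ 2) := by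
      funext ω; simp only [hX, hV]; ring
    have a := iXV 2 0 (by norm_num) (by norm_num)
    have b := (iXV 1 1 (by norm_num) (by norm_num)).const_mul (-2)
    have c := iXV 0 2 (by norm_num) (by norm_num)
    rw [this, integral_add a (b.fun_add c), integral_add b c, integral_const_mul,
      eXV 2 0 (by norm_num) (by norm_num), eXV 1 1 (by norm_num) (by norm_num),
      eXV 0 2 (by norm_num) (by norm_num), e0, e1, e2]
    ring
  have E4 : ∫ ω, (Y ω - Z ω) ^ 4 ∂μ = 2 * μ₄ + 6 * μ₂ ^ 2 := by
    have : (fun ω => (Y ω - Z ω) ^ 4) = fun ω => X ω ^ 4 * V ω ^ 0 +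
        ((-4) * (X ω ^ 3 * V ω ^ 1) + (6 * (X ω ^ 2 * V ω ^ 2) +
          ((-4) * (X ω ^ 1 * V ω ^ 3) + X ω ^ 0 * V ω ^ 4))) := by
      funext ω; simp only [hX, hV]; ring
    have a := iXV 4 0 (by norm_num) (by norm_num)
    have b := (iXV 3 1 (by norm_num) (by norm_num)).const_mul (-4)
    have c := (iXV 2 2 (by norm_num) (by norm_num)).const_mul 6
    have d := (iXV 1 3 (by norm_num) (by norm_num)).const_mul (-4)
    have e := iXV 0 4 (by norm_num) (by norm_num)
    rw [this, integral_add a (b.fun_add (c.fun_add (d.fun_add e))), integral_add b (c.fun_add (d.fun_add e)),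
      integral_add c (d.fun_add e), integral_add d e, integral_const_mul, integral_const_mul,
      integral_const_mul,
      eXV 4 0 (by norm_num) (by norm_num), eXV 3 1 (by norm_num) (by norm_num),
      eXV 2 2 (by norm_num) (by norm_num), eXV 1 3 (by norm_num) (by norm_num),
      eXV 0 4 (by norm_num) (by norm_num), e0, e1, e2, e4]
    ring
  have hWL : MemLp (fun ω => Y ω - Z ω) 4 μ := hYL.sub hZL
  have iW := aux_int μ _ hWL
  have iA : Integrable (fun ω => |Y ω - Z ω|) μ := (hWL.integrable (by norm_num)).abs
  have hA : 0 ≤ ∫ ω, |Y ω - Z ω| ∂μ := integral_nonneg fun ω => abs_nonneg _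
  have hm2 : 0 ≤ μ₂ := by rw [hμ₂]; exact integral_nonneg fun ω => by positivity
  have hm4 : 0 ≤ μ₄ := by rw [hμ₄]; exact integral_nonneg fun ω => by positivity
  rcases hm2.eq_or_lt with h0 | hpos
  · rw [← h0]; simpa using hA
  have key := aux_final (∫ ω, |Y ω - Z ω| ∂μ) (2 * μ₂) (2 * μ₄ + 6 * μ₂ ^ 2) hA (by positivity)
    (by positivity) (fun c hc => by
      rw [← E2, ← E4, ← integral_const_mul, ← integral_const_mul,
        ← integral_add (iA.const_mul _) (iW 4 le_rfl)]
      exact integral_mono ((iW 2 (by norm_num)).const_mul _)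
        ((iA.const_mul _).add (iW 4 le_rfl)) fun ω => aux_pt c _ hc)
  have : Real.sqrt (μ₂ ^ 3 / (μ₄ + 3 * μ₂ ^ 2)) ≤ (∫ ω, |Y ω - Z ω| ∂μ) / 2 := by
    apply Real.sqrt_le_iff.2 ⟨by positivity, ?_⟩
    rw [div_le_iff₀ (by positivity)]
    nlinarith
  linarith
end
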